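/- arXiv:2007.12823 — 10 statements merged into one kernel-verified Lean document; each statement's English description precedes it below -/
import Mathlib

section
/- Let g satisfy conditions (C1)–(C3). Then for all fixed γ, τ, y ∈ [0,1], the map θ ↦ h(γ,τ,θ,y) is 1-Lipschitz on [0,1]; that is, |h(γ,τ,θ,y) − h(γ,τ,θ',y)| ≤ |θ − θ'| for all θ, θ' ∈ [0,1]. -/
open Set MeasureTheory

noncomputable def hFun (g : ℝ → ℝ → ℝ) (γ τ θ y : ℝ) : ℝ :=
  (1 - g θ y) + (∫ x in (0:ℝ)..θ, g x y) + ∫ x in θ..γ, g x τ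

noncomputable def qFun (g : ℝ → ℝ → ℝ) (γ τ y : ℝ) : ℝ :=
  sInf ((fun θ => hFun g γ τ θ y) '' Set.Icc 0 γ)

noncomputable def pFun (g : ℝ → ℝ → ℝ) (γ τ : ℝ) : ℝ :=
  (1 - γ) * (1 - τ) + (1 - τ) * ∫ x in (0:ℝ)..γ, g x τ

noncomputable def fFun (g : ℝ → ℝ → ℝ) (γ τ : ℝ) : ℝ :=
  pFun g γ τ + ∫ y in (0:ℝ)..τ, qFun g γ τ y

theorem stmt2 (g gx : ℝ → ℝ → ℝ)
    (hcont : ContinuousOn (Function.uncurry g) (Set.Icc 0 1 ×ˢ Set.Icc 0 1))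
    (hrange : ∀ x ∈ Set.Icc (0:ℝ) 1, ∀ y ∈ Set.Icc (0:ℝ) 1, g x y ∈ Set.Icc (0:ℝ) 1)
    (hmono : ∀ y ∈ Set.Icc (0:ℝ) 1, MonotoneOn (fun x => g x y) (Set.Icc 0 1))
    (hanti : ∀ x ∈ Set.Icc (0:ℝ) 1, AntitoneOn (fun y => g x y) (Set.Icc 0 1))
    (hderx : ∀ x ∈ Set.Icc (0:ℝ) 1, ∀ y ∈ Set.Icc (0:ℝ) 1,
      HasDerivWithinAt (fun x' => g x' y) (gx x y) (Set.Icc 0 1) x)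
    (hC3 : ∀ x ∈ Set.Icc (0:ℝ) 1, ∀ y ∈ Set.Icc (0:ℝ) 1, gx x y ≤ g x y)
    :
    ∀ γ ∈ Set.Icc (0:ℝ) 1, ∀ τ ∈ Set.Icc (0:ℝ) 1, ∀ y ∈ Set.Icc (0:ℝ) 1,
      ∀ θ ∈ Set.Icc (0:ℝ) 1, ∀ θ' ∈ Set.Icc (0:ℝ) 1,
        |hFun g γ τ θ y - hFun g γ τ θ' y| ≤ |θ - θ'| := by
  intro γ hγ τ hτ y hy
  have hext : ∀ z ∈ Set.Icc (0:ℝ) 1, ∃ G : ℝ → ℝ, Continuous G ∧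
      ∀ x ∈ Set.Icc (0:ℝ) 1, G x = g x z := by
    intro z hz
    have hc : ContinuousOn (fun x => g x z) (Set.Icc 0 1) :=
      fun x hx => (hderx x hx z hz).continuousWithinAt
    refine ⟨Set.IccExtend (zero_le_one) ((Set.Icc (0:ℝ) 1).restrict (fun x => g x z)),
      (continuousOn_iff_continuous_restrict.mp hc).Icc_extend', ?_⟩
    intro x hx
    rw [Set.IccExtend_of_mem _ _ hx]
    rfl
  obtain ⟨G, hGc, hG⟩ := hext y hy
  obtain ⟨H, hHc, hH⟩ := hext τ hτ
  have heq : ∀ θ ∈ Set.Icc (0:ℝ) 1, hFun g γ τ θ y =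
      (1 - g θ y) + (∫ x in (0:ℝ)..θ, G x) + ((∫ x in (0:ℝ)..γ, H x) - ∫ x in (0:ℝ)..θ, H x) := by
    intro θ hθ
    unfold hFun
    rw [intervalIntegral.integral_interval_sub_left (hHc.intervalIntegrable _ _)
      (hHc.intervalIntegrable _ _)]
    congr 1
    · congr 1
      apply intervalIntegral.integral_congr
      intro x hx
      exact (hG x (Set.uIcc_subset_Icc (by simp) hθ hx)).symm
    · apply intervalIntegral.integral_congr
      intro x hx
      exact (hH x (Set.uIcc_subset_Icc hθ hγ hx)).symm
  have hder : ∀ θ ∈ Set.Icc (0:ℝ) 1, HasDerivWithinAt (fun θ => hFun g γ τ θ y)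
      (-gx θ y + g θ y - g θ τ) (Set.Icc 0 1) θ := by
    intro θ hθ
    have h1 := (hGc.integral_hasStrictDerivAt 0 θ).hasDerivAt.hasDerivWithinAt (s := Set.Icc 0 1)
    have h2 := (hHc.integral_hasStrictDerivAt 0 θ).hasDerivAt.hasDerivWithinAt (s := Set.Icc 0 1)
    have h3 := (((hderx θ hθ y hy).const_sub 1).add h1).add
      (h2.const_sub (∫ x in (0:ℝ)..γ, H x))
    rw [hG θ hθ, hH θ hθ] at h3
    exact h3.congr heq (heq θ hθ)
  intro θ hθ θ' hθ'
  have key := (convex_Icc (0:ℝ) 1).norm_image_sub_le_of_norm_hasDerivWithin_le (C := 1) hder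
    (fun x hx => by
      have h0 : 0 ≤ gx x y := by
        rw [← (hderx x hx y hy).derivWithin (uniqueDiffOn_Icc zero_lt_one x hx)]
        exact (hmono y hy).derivWithin_nonneg
      have h1 := hC3 x hx y hy
      have h2 := hrange x hx y hy
      have h3 := hrange x hx τ hτ
      rw [Real.norm_eq_abs, abs_le]
      constructor <;> linarith [h2.1, h2.2, h3.1, h3.2]) hθ' hθ
  simpa [Real.norm_eq_abs] using key
end

section
/- Let g satisfy conditions (C1), (C2), (C4). Then for all fixed γ, τ, θ ∈ [0,1], the map y ↦ h(γ,τ,θ,y) is 1-Lipschitz on [0,1]; that is, |h(γ,τ,θ,y) − h(γ,τ,θ,y')| ≤ |y − y'| for all y, y' ∈ [0,1]. -/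
open Set MeasureTheory

theorem stmt3 (g gy : ℝ → ℝ → ℝ)
    (hcont : ContinuousOn (Function.uncurry g) (Set.Icc 0 1 ×ˢ Set.Icc 0 1))
    (hrange : ∀ x ∈ Set.Icc (0:ℝ) 1, ∀ y ∈ Set.Icc (0:ℝ) 1, g x y ∈ Set.Icc (0:ℝ) 1)
    (hmono : ∀ y ∈ Set.Icc (0:ℝ) 1, MonotoneOn (fun x => g x y) (Set.Icc 0 1))
    (hanti : ∀ x ∈ Set.Icc (0:ℝ) 1, AntitoneOn (fun y => g x y) (Set.Icc 0 1))
    (hdery : ∀ x ∈ Set.Icc (0:ℝ) 1, ∀ y ∈ Set.Icc (0:ℝ) 1,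
      HasDerivWithinAt (fun y' => g x y') (gy x y) (Set.Icc 0 1) y)
    (hC4 : ∀ x ∈ Set.Icc (0:ℝ) 1, ∀ y ∈ Set.Icc (0:ℝ) 1, g x y - 1 ≤ gy x y)
    :
    ∀ γ ∈ Set.Icc (0:ℝ) 1, ∀ τ ∈ Set.Icc (0:ℝ) 1, ∀ θ ∈ Set.Icc (0:ℝ) 1,
      ∀ y ∈ Set.Icc (0:ℝ) 1, ∀ y' ∈ Set.Icc (0:ℝ) 1,
        |hFun g γ τ θ y - hFun g γ τ θ y'| ≤ |y - y'| := by
  have key : ∀ x ∈ Set.Icc (0:ℝ) 1, ∀ y ∈ Set.Icc (0:ℝ) 1, ∀ y' ∈ Set.Icc (0:ℝ) 1, y ≤ y' →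
      0 ≤ g x y - g x y' ∧ g x y - g x y' ≤ y' - y := by
    intro x hx y hy y' hy' hyy
    refine ⟨sub_nonneg.2 (hanti x hx hy hy' hyy), ?_⟩
    have hm : MonotoneOn (fun t => g x t + t) (Set.Icc (0:ℝ) 1) := by
      apply monotoneOn_of_hasDerivWithinAt_nonneg (f' := fun t => gy x t + 1) (convex_Icc 0 1)
      · intro t ht
        exact ((hdery x hx t ht).continuousWithinAt).add continuousWithinAt_id
      · intro t ht
        exact ((hdery x hx t (interior_subset ht)).mono interior_subset).add
          (hasDerivWithinAt_id t _)
      · intro t ht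
        have h1 := hC4 x hx t (interior_subset ht)
        have h2 := (hrange x hx t (interior_subset ht)).1
        linarith
    have := hm hy hy' hyy
    simp only at this
    linarith
  have main : ∀ γ ∈ Set.Icc (0:ℝ) 1, ∀ τ ∈ Set.Icc (0:ℝ) 1, ∀ θ ∈ Set.Icc (0:ℝ) 1,
      ∀ y ∈ Set.Icc (0:ℝ) 1, ∀ y' ∈ Set.Icc (0:ℝ) 1, y ≤ y' →
        |hFun g γ τ θ y - hFun g γ τ θ y'| ≤ y' - y := by
    intro γ _ τ _ θ hθ y hy y' hy' hyy
    have hint : ∀ t ∈ Set.Icc (0:ℝ) 1,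
        IntervalIntegrable (fun x => g x t) volume 0 θ := by
      intro t ht
      apply MonotoneOn.intervalIntegrable
      rw [Set.uIcc_of_le hθ.1]
      exact (hmono t ht).mono (Set.Icc_subset_Icc_right hθ.2)
    have hsub := intervalIntegral.integral_sub (hint y hy) (hint y' hy')
    have h0 : 0 ≤ ∫ x in (0:ℝ)..θ, (g x y - g x y') :=
      intervalIntegral.integral_nonneg hθ.1
        (fun x hx => (key x ⟨hx.1, hx.2.trans hθ.2⟩ y hy y' hy' hyy).1)
    have h1 : ∫ x in (0:ℝ)..θ, (g x y - g x y') ≤ ∫ x in (0:ℝ)..θ, (y' - y) :=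
      intervalIntegral.integral_mono_on hθ.1 ((hint y hy).sub (hint y' hy'))
        intervalIntegrable_const
        (fun x hx => (key x ⟨hx.1, hx.2.trans hθ.2⟩ y hy y' hy' hyy).2)
    rw [intervalIntegral.integral_const, smul_eq_mul, sub_zero] at h1
    have h2 : θ * (y' - y) ≤ y' - y := by
      nlinarith [hθ.2]
    have h3 := key θ hθ y hy y' hy' hyy
    unfold hFun
    rw [abs_le]
    constructor <;> linarith [h3.1, h3.2]
  intro γ hγ τ hτ θ hθ y hy y' hy'
  rcases le_total y y' with h | h
  · rw [abs_sub_comm y y', abs_of_nonneg (sub_nonneg.2 h)]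
    exact main γ hγ τ hτ θ hθ y hy y' hy' h
  · rw [abs_sub_comm, abs_of_nonneg (sub_nonneg.2 h)]
    exact main γ hγ τ hτ θ hθ y' hy' y hy h
end

section
/- Let g satisfy conditions (C1), (C2), (C4). Then for all fixed γ, τ ∈ [0,1], the map y ↦ q(γ,τ,y) is 1-Lipschitz on [0,1], where q(γ,τ,y) = min over θ ∈ [0,γ] of h(γ,τ,θ,y). -/
open Set MeasureTheory

theorem stmt4 (g gy : ℝ → ℝ → ℝ)
    (hcont : ContinuousOn (Function.uncurry g) (Set.Icc 0 1 ×ˢ Set.Icc 0 1))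
    (hrange : ∀ x ∈ Set.Icc (0:ℝ) 1, ∀ y ∈ Set.Icc (0:ℝ) 1, g x y ∈ Set.Icc (0:ℝ) 1)
    (hmono : ∀ y ∈ Set.Icc (0:ℝ) 1, MonotoneOn (fun x => g x y) (Set.Icc 0 1))
    (hanti : ∀ x ∈ Set.Icc (0:ℝ) 1, AntitoneOn (fun y => g x y) (Set.Icc 0 1))
    (hdery : ∀ x ∈ Set.Icc (0:ℝ) 1, ∀ y ∈ Set.Icc (0:ℝ) 1,
      HasDerivWithinAt (fun y' => g x y') (gy x y) (Set.Icc 0 1) y)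
    (hC4 : ∀ x ∈ Set.Icc (0:ℝ) 1, ∀ y ∈ Set.Icc (0:ℝ) 1, g x y - 1 ≤ gy x y)
    :
    ∀ γ ∈ Set.Icc (0:ℝ) 1, ∀ τ ∈ Set.Icc (0:ℝ) 1,
      ∀ y ∈ Set.Icc (0:ℝ) 1, ∀ y' ∈ Set.Icc (0:ℝ) 1,
        |qFun g γ τ y - qFun g γ τ y'| ≤ |y - y'| := by
  have key : ∀ x ∈ Set.Icc (0:ℝ) 1, ∀ a ∈ Set.Icc (0:ℝ) 1, ∀ b ∈ Set.Icc (0:ℝ) 1, a ≤ b →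
      g x a - g x b ≤ b - a := by
    intro x hx a ha b hb hab
    have hd : ∀ z ∈ interior (Set.Icc (0:ℝ) 1), HasDerivAt (fun y' => g x y') (gy x z) z := by
      intro z hz
      exact (hdery x hx z (interior_subset hz)).hasDerivAt (mem_interior_iff_mem_nhds.mp hz)
    have h := (convex_Icc (0:ℝ) 1).mul_sub_le_image_sub_of_le_deriv (f := fun y' => g x y')
      (C := -1) (fun z hz => (hdery x hx z hz).continuousWithinAt)
      (fun z hz => (hd z hz).differentiableAt.differentiableWithinAt)
      (fun z hz => by
        rw [(hd z hz).deriv]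
        have h1 := hC4 x hx z (interior_subset hz)
        have h2 := (hrange x hx z (interior_subset hz)).1
        linarith) a ha b hb hab
    try simp only at h
    linarith
  have hint : ∀ y ∈ Set.Icc (0:ℝ) 1, ∀ a ∈ Set.Icc (0:ℝ) 1, ∀ b ∈ Set.Icc (0:ℝ) 1,
      IntervalIntegrable (fun x => g x y) volume a b := by
    intro y hy a ha b hb
    apply MonotoneOn.intervalIntegrable
    exact (hmono y hy).mono (Set.uIcc_subset_Icc ha hb)
  intro γ hγ τ hτ
  have z0 : (0:ℝ) ∈ Set.Icc (0:ℝ) 1 := by simp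
  have hle : ∀ θ ∈ Set.Icc (0:ℝ) γ, ∀ a ∈ Set.Icc (0:ℝ) 1, ∀ b ∈ Set.Icc (0:ℝ) 1, a ≤ b →
      |hFun g γ τ θ a - hFun g γ τ θ b| ≤ b - a := by
    intro θ hθ a ha b hb hab
    have hθ1 : θ ∈ Set.Icc (0:ℝ) 1 := ⟨hθ.1, hθ.2.trans hγ.2⟩
    have h1 := key θ hθ1 a ha b hb hab
    have h2 := hanti θ hθ1 ha hb hab
    have ia := hint a ha 0 z0 θ hθ1
    have ib := hint b hb 0 z0 θ hθ1
    have h3 : (∫ x in (0:ℝ)..θ, g x b) ≤ ∫ x in (0:ℝ)..θ, g x a :=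
      intervalIntegral.integral_mono_on hθ.1 ib ia
        (fun x hx => hanti x ⟨hx.1, hx.2.trans hθ1.2⟩ ha hb hab)
    have h4 : (∫ x in (0:ℝ)..θ, (g x a - g x b)) ≤ ∫ x in (0:ℝ)..θ, (b - a) :=
      intervalIntegral.integral_mono_on hθ.1 (ia.sub ib) intervalIntegrable_const
        (fun x hx => key x ⟨hx.1, hx.2.trans hθ1.2⟩ a ha b hb hab)
    rw [intervalIntegral.integral_sub ia ib, intervalIntegral.integral_const, smul_eq_mul] at h4
    have h5 : (θ - 0) * (b - a) ≤ b - a := by nlinarith [hθ1.2]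
    try simp only at h2
    unfold hFun
    rw [abs_le]
    constructor <;> linarith
  have hbdd : ∀ y ∈ Set.Icc (0:ℝ) 1, BddBelow ((fun θ => hFun g γ τ θ y) '' Set.Icc 0 γ) := by
    intro y hy
    refine ⟨0, ?_⟩
    rintro _ ⟨θ, hθ, rfl⟩
    have hθ1 : θ ∈ Set.Icc (0:ℝ) 1 := ⟨hθ.1, hθ.2.trans hγ.2⟩
    have h1 := (hrange θ hθ1 y hy).2
    have h2 : 0 ≤ ∫ x in (0:ℝ)..θ, g x y := intervalIntegral.integral_nonneg hθ.1
      (fun x hx => (hrange x ⟨hx.1, hx.2.trans hθ1.2⟩ y hy).1)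
    have h3 : 0 ≤ ∫ x in θ..γ, g x τ := intervalIntegral.integral_nonneg hθ.2
      (fun x hx => (hrange x ⟨hθ.1.trans hx.1, hx.2.trans hγ.2⟩ τ hτ).1)
    simp only [hFun]
    linarith
  have hle' : ∀ θ ∈ Set.Icc (0:ℝ) γ, ∀ a ∈ Set.Icc (0:ℝ) 1, ∀ b ∈ Set.Icc (0:ℝ) 1,
      hFun g γ τ θ a ≤ hFun g γ τ θ b + |a - b| := by
    intro θ hθ a ha b hb
    rcases le_total a b with hab | hab
    · have := (abs_le.mp (hle θ hθ a ha b hb hab)).2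
      rw [abs_sub_comm, abs_of_nonneg (sub_nonneg.mpr hab)]
      linarith
    · have := (abs_le.mp (hle θ hθ b hb a ha hab)).1
      rw [abs_of_nonneg (sub_nonneg.mpr hab)]
      linarith
  have hq : ∀ a ∈ Set.Icc (0:ℝ) 1, ∀ b ∈ Set.Icc (0:ℝ) 1,
      qFun g γ τ a - |a - b| ≤ qFun g γ τ b := by
    intro a ha b hb
    apply le_csInf
    · exact (Set.nonempty_Icc.mpr hγ.1).image _
    · rintro _ ⟨θ, hθ, rfl⟩
      have h1 : qFun g γ τ a ≤ hFun g γ τ θ a := csInf_le (hbdd a ha) ⟨θ, hθ, rfl⟩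
      have h2 := hle' θ hθ a ha b hb
      try simp only
      linarith
  intro y hy y' hy'
  have h1 := hq y hy y' hy'
  have h2 := hq y' hy' y hy
  rw [abs_sub_comm y' y] at h2
  rw [abs_le]
  constructor <;> linarith
end

section
/- (Lemma 5.1, first part.) Let g satisfy conditions (C1)–(C4). Then the function f(γ,τ) is 1-Lipschitz in γ: for all γ, γ', τ ∈ [0,1], |f(γ,τ) − f(γ',τ)| ≤ |γ − γ'|. -/
open Set MeasureTheory

theorem aux_lip (u u' : ℝ → ℝ) 
    (hd : ∀ x ∈ Set.Icc (0:ℝ) 1, HasDerivWithinAt u (u' x) (Set.Icc 0 1) x)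
    (hb : ∀ x ∈ Set.Icc (0:ℝ) 1, |u' x| ≤ 1) :
    ∀ x ∈ Set.Icc (0:ℝ) 1, ∀ y ∈ Set.Icc (0:ℝ) 1, |u y - u x| ≤ |y - x| := by
  intro x hx y hy
  have := Convex.norm_image_sub_le_of_norm_hasDerivWithin_le (C := 1) hd hb (convex_Icc 0 1) hx hy
  simpa using this

theorem aux_integral_abs (u v : ℝ → ℝ) (a b c : ℝ) (ha : 0 ≤ a) (hab : a ≤ b) (hb : b ≤ 1)
    (hu : ContinuousOn u (Set.Icc 0 1)) (hv : ContinuousOn v (Set.Icc 0 1))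
    (h : ∀ x ∈ Set.Icc (0:ℝ) 1, u x ≤ v x + c) (hc : 0 ≤ c) :
    ∫ x in a..b, u x ≤ (∫ x in a..b, v x) + c * (b - a) := by
  have hsub : Set.uIcc a b ⊆ Set.Icc 0 1 := by
    rw [Set.uIcc_of_le hab]; exact Set.Icc_subset_Icc ha hb
  have iu := (hu.mono hsub).intervalIntegrable (μ := volume)
  have iv := (hv.mono hsub).intervalIntegrable (μ := volume)
  have e : (∫ x in a..b, v x) + c * (b - a) = ∫ x in a..b, (v x + c) := by
    rw [intervalIntegral.integral_add iv (by simp)]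
    simp; ring
  rw [e]
  apply intervalIntegral.integral_mono_on hab iu (iv.add (by simp))
  intro x hx
  exact h x ⟨ha.trans hx.1, hx.2.trans hb⟩

theorem stmt6 (g gx gy : ℝ → ℝ → ℝ)
    (hcont : ContinuousOn (Function.uncurry g) (Set.Icc 0 1 ×ˢ Set.Icc 0 1))
    (hrange : ∀ x ∈ Set.Icc (0:ℝ) 1, ∀ y ∈ Set.Icc (0:ℝ) 1, g x y ∈ Set.Icc (0:ℝ) 1)
    (hmono : ∀ y ∈ Set.Icc (0:ℝ) 1, MonotoneOn (fun x => g x y) (Set.Icc 0 1))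
    (hanti : ∀ x ∈ Set.Icc (0:ℝ) 1, AntitoneOn (fun y => g x y) (Set.Icc 0 1))
    (hderx : ∀ x ∈ Set.Icc (0:ℝ) 1, ∀ y ∈ Set.Icc (0:ℝ) 1,
      HasDerivWithinAt (fun x' => g x' y) (gx x y) (Set.Icc 0 1) x)
    (hC3 : ∀ x ∈ Set.Icc (0:ℝ) 1, ∀ y ∈ Set.Icc (0:ℝ) 1, gx x y ≤ g x y)
    (hdery : ∀ x ∈ Set.Icc (0:ℝ) 1, ∀ y ∈ Set.Icc (0:ℝ) 1,
      HasDerivWithinAt (fun y' => g x y') (gy x y) (Set.Icc 0 1) y)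
    (hC4 : ∀ x ∈ Set.Icc (0:ℝ) 1, ∀ y ∈ Set.Icc (0:ℝ) 1, g x y - 1 ≤ gy x y)
    :
    ∀ γ ∈ Set.Icc (0:ℝ) 1, ∀ γ' ∈ Set.Icc (0:ℝ) 1, ∀ τ ∈ Set.Icc (0:ℝ) 1,
      |fFun g γ τ - fFun g γ' τ| ≤ |γ - γ'| := by
  have sx : ∀ x ∈ Set.Icc (0:ℝ) 1, UniqueDiffWithinAt ℝ (Set.Icc (0:ℝ) 1) x :=
    uniqueDiffOn_Icc one_pos
  have cx : ∀ y ∈ Set.Icc (0:ℝ) 1, ContinuousOn (fun x => g x y) (Set.Icc 0 1) :=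
    fun y hy x hx => (hderx x hx y hy).continuousWithinAt
  have lx : ∀ y ∈ Set.Icc (0:ℝ) 1, ∀ x ∈ Set.Icc (0:ℝ) 1, ∀ x' ∈ Set.Icc (0:ℝ) 1,
      |g x' y - g x y| ≤ |x' - x| := by
    intro y hy
    apply aux_lip (fun x => g x y) (fun x => gx x y) (fun x hx => hderx x hx y hy)
    intro x hx
    have h0 : 0 ≤ gx x y := by
      rw [← (hderx x hx y hy).derivWithin (sx x hx)]
      exact (hmono y hy).derivWithin_nonneg
    rw [abs_of_nonneg h0]
    exact (hC3 x hx y hy).trans (hrange x hx y hy).2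
  have ly : ∀ x ∈ Set.Icc (0:ℝ) 1, ∀ y ∈ Set.Icc (0:ℝ) 1, ∀ y' ∈ Set.Icc (0:ℝ) 1,
      |g x y' - g x y| ≤ |y' - y| := by
    intro x hx
    apply aux_lip (fun y => g x y) (fun y => gy x y) (fun y hy => hdery x hx y hy)
    intro y hy
    have h0 : gy x y ≤ 0 := by
      rw [← (hdery x hx y hy).derivWithin (sx y hy)]
      exact (hanti x hx).derivWithin_nonpos
    rw [abs_le]
    have h1 := hC4 x hx y hy
    have h2 := (hrange x hx y hy).1
    constructor <;> linarith
  have ii : ∀ y ∈ Set.Icc (0:ℝ) 1, ∀ a ∈ Set.Icc (0:ℝ) 1, ∀ b ∈ Set.Icc (0:ℝ) 1,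
      IntervalIntegrable (fun x => g x y) volume a b := fun y hy a ha b hb =>
    ((cx y hy).mono (Set.uIcc_subset_Icc ha hb)).intervalIntegrable
  have i0 : ∀ y ∈ Set.Icc (0:ℝ) 1, ∀ a ∈ Set.Icc (0:ℝ) 1, ∀ b ∈ Set.Icc (0:ℝ) 1, a ≤ b →
      0 ≤ ∫ x in a..b, g x y := by
    intro y hy a ha b hb hab
    apply intervalIntegral.integral_nonneg hab
    intro x hx
    exact (hrange x ⟨ha.1.trans hx.1, hx.2.trans hb.2⟩ y hy).1
  have i1 : ∀ y ∈ Set.Icc (0:ℝ) 1, ∀ a ∈ Set.Icc (0:ℝ) 1, ∀ b ∈ Set.Icc (0:ℝ) 1, a ≤ b →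
      ∫ x in a..b, g x y ≤ b - a := by
    intro y hy a ha b hb hab
    have := aux_integral_abs (fun x => g x y) (fun _ => 0) a b 1 ha.1 hab hb.2 (cx y hy)
      continuousOn_const (fun x hx => by simpa using (hrange x hx y hy).2) one_pos.le
    simpa using this
  have h0 : ∀ γ ∈ Set.Icc (0:ℝ) 1, ∀ τ ∈ Set.Icc (0:ℝ) 1, ∀ y ∈ Set.Icc (0:ℝ) 1,
      ∀ θ ∈ Set.Icc (0:ℝ) γ, 0 ≤ hFun g γ τ θ y := by
    intro γ hγ τ hτ y hy θ hθ
    have hθ' : θ ∈ Set.Icc (0:ℝ) 1 := ⟨hθ.1, hθ.2.trans hγ.2⟩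
    have a1 := i0 y hy 0 (by simp) θ hθ' hθ.1
    have a2 := i0 τ hτ θ hθ' γ hγ hθ.2
    have a3 := (hrange θ hθ' y hy).2
    unfold hFun
    linarith
  have qle : ∀ γ ∈ Set.Icc (0:ℝ) 1, ∀ τ ∈ Set.Icc (0:ℝ) 1, ∀ y ∈ Set.Icc (0:ℝ) 1,
      ∀ θ ∈ Set.Icc (0:ℝ) γ, qFun g γ τ y ≤ hFun g γ τ θ y := by
    intro γ hγ τ hτ y hy θ hθ
    apply csInf_le
    · refine ⟨0, ?_⟩
      rintro _ ⟨t, ht, rfl⟩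
      exact h0 γ hγ τ hτ y hy t ht
    · exact ⟨θ, hθ, rfl⟩
  have leq : ∀ γ ∈ Set.Icc (0:ℝ) 1, ∀ τ y c : ℝ,
      (∀ θ ∈ Set.Icc (0:ℝ) γ, c ≤ hFun g γ τ θ y) → c ≤ qFun g γ τ y := by
    intro γ hγ τ y c h
    apply le_csInf
    · exact ⟨_, 0, ⟨le_rfl, hγ.1⟩, rfl⟩
    · rintro _ ⟨t, ht, rfl⟩
      exact h t ht
  have qlip : ∀ γ ∈ Set.Icc (0:ℝ) 1, ∀ τ ∈ Set.Icc (0:ℝ) 1, ∀ y ∈ Set.Icc (0:ℝ) 1,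
      ∀ y' ∈ Set.Icc (0:ℝ) 1, qFun g γ τ y ≤ qFun g γ τ y' + 2 * |y - y'| := by
    intro γ hγ τ hτ y hy y' hy'
    rw [← sub_le_iff_le_add]
    apply leq γ hγ
    intro θ hθ
    have hθ' : θ ∈ Set.Icc (0:ℝ) 1 := ⟨hθ.1, hθ.2.trans hγ.2⟩
    have a1 := qle γ hγ τ hτ y hy θ hθ
    have a2 := abs_le.1 (ly θ hθ' y' hy' y hy)
    have a3 := aux_integral_abs (fun x => g x y) (fun x => g x y') 0 θ |y - y'| le_rfl hθ.1
      hθ'.2 (cx y hy) (cx y' hy')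
      (fun x hx => by have := abs_le.1 (ly x hx y' hy' y hy); linarith [this.2]) (abs_nonneg _)
    have a4 : |y - y'| * (θ - 0) ≤ |y - y'| := by
      nlinarith [abs_nonneg (y - y'), hθ'.2]
    unfold hFun at a1 ⊢
    linarith [a2.1]
  have qint : ∀ γ ∈ Set.Icc (0:ℝ) 1, ∀ τ ∈ Set.Icc (0:ℝ) 1,
      IntervalIntegrable (fun y => qFun g γ τ y) volume 0 τ := by
    intro γ hγ τ hτ
    have hl : LipschitzOnWith 2 (fun y => qFun g γ τ y) (Set.Icc 0 1) := by
      apply LipschitzOnWith.of_le_add_mul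
      intro y hy y' hy'
      simpa [Real.dist_eq] using qlip γ hγ τ hτ y hy y' hy'
    exact (hl.continuousOn.mono (Set.uIcc_subset_Icc (by simp) hτ)).intervalIntegrable
  have key : ∀ a ∈ Set.Icc (0:ℝ) 1, ∀ b ∈ Set.Icc (0:ℝ) 1, ∀ τ ∈ Set.Icc (0:ℝ) 1, a ≤ b →
      |fFun g a τ - fFun g b τ| ≤ b - a := by
    intro a ha b hb τ hτ hab
    have b0 := i0 τ hτ a ha b hb hab
    have b1 := i1 τ hτ a ha b hb hab
    have up : ∀ y ∈ Set.Icc (0:ℝ) 1, qFun g b τ y ≤ qFun g a τ y + (b - a) := by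
      intro y hy
      rw [← sub_le_iff_le_add]
      apply leq a ha
      intro θ hθ
      have hθ' : θ ∈ Set.Icc (0:ℝ) 1 := ⟨hθ.1, hθ.2.trans ha.2⟩
      have a1 := qle b hb τ hτ y hy θ ⟨hθ.1, hθ.2.trans hab⟩
      have a2 := intervalIntegral.integral_add_adjacent_intervals
        (ii τ hτ θ hθ' a ha) (ii τ hτ a ha b hb)
      unfold hFun at a1 ⊢
      linarith
    have lo : ∀ y ∈ Set.Icc (0:ℝ) 1, qFun g a τ y ≤ qFun g b τ y + (b - a) := by
      intro y hy
      rw [← sub_le_iff_le_add]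
      apply leq b hb
      intro θ hθ
      have hθ' : θ ∈ Set.Icc (0:ℝ) 1 := ⟨hθ.1, hθ.2.trans hb.2⟩
      rcases le_total θ a with h | h
      · have a1 := qle a ha τ hτ y hy θ ⟨hθ.1, h⟩
        have a2 := intervalIntegral.integral_add_adjacent_intervals
          (ii τ hτ θ hθ' a ha) (ii τ hτ a ha b hb)
        unfold hFun at a1 ⊢
        linarith
      · have a1 := qle a ha τ hτ y hy a ⟨ha.1, le_rfl⟩
        have a2 := intervalIntegral.integral_add_adjacent_intervals
          (ii y hy 0 (by simp) a ha) (ii y hy a ha θ hθ')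
        have a3 := i0 y hy a ha θ hθ' h
        have a4 := i0 τ hτ θ hθ' b hb hθ.2
        have a5 := (abs_le.1 (lx y hy a ha θ hθ')).2
        rw [abs_of_nonneg (sub_nonneg.2 h)] at a5
        unfold hFun at a1 ⊢
        rw [intervalIntegral.integral_same] at a1
        linarith [hθ.2]
    have mem : ∀ y ∈ Set.Icc (0:ℝ) τ, y ∈ Set.Icc (0:ℝ) 1 := fun y hy => ⟨hy.1, hy.2.trans hτ.2⟩
    have e : ∀ u : ℝ → ℝ, IntervalIntegrable u volume 0 τ →
        ∫ y in (0:ℝ)..τ, (u y + (b - a)) = (∫ y in (0:ℝ)..τ, u y) + τ * (b - a) := by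
      intro u hu
      rw [intervalIntegral.integral_add hu (by simp)]
      simp; ring
    have U := intervalIntegral.integral_mono_on hτ.1 (qint b hb τ hτ)
      ((qint a ha τ hτ).add (by simp)) (fun y hy => up y (mem y hy))
    have L := intervalIntegral.integral_mono_on hτ.1 (qint a ha τ hτ)
      ((qint b hb τ hτ).add (by simp)) (fun y hy => lo y (mem y hy))
    rw [e _ (qint a ha τ hτ)] at U
    rw [e _ (qint b hb τ hτ)] at L
    have a2 := intervalIntegral.integral_add_adjacent_intervals
      (ii τ hτ 0 (by simp) a ha) (ii τ hτ a ha b hb)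
    unfold fFun pFun
    rw [← a2, abs_le]
    have c1 := mul_nonneg (sub_nonneg.2 hτ.2) b0
    have c2 := mul_nonneg (sub_nonneg.2 hτ.2) (sub_nonneg.2 b1)
    have c3 := mul_nonneg (sub_nonneg.2 hτ.2) (sub_nonneg.2 hab)
    constructor <;> nlinarith
  intro γ hγ γ' hγ' τ hτ
  rcases le_total γ γ' with h | h
  · rw [abs_sub_comm γ γ', abs_of_nonneg (sub_nonneg.2 h)]
    exact key γ hγ γ' hγ' τ hτ h
  · rw [abs_sub_comm (fFun g γ τ), abs_of_nonneg (sub_nonneg.2 h)]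
    exact key γ' hγ' γ hγ τ hτ h
end

section
/- (Lemma 5.1, second part.) Let g satisfy conditions (C1)–(C4). Then the function f(γ,τ) is 3-Lipschitz in τ: for all γ, τ, τ' ∈ [0,1], |f(γ,τ) − f(γ,τ')| ≤ 3|τ − τ'|. -/
open Set MeasureTheory

theorem aux_lip_s7 (g gy : ℝ → ℝ → ℝ)
    (hrange : ∀ x ∈ Set.Icc (0:ℝ) 1, ∀ y ∈ Set.Icc (0:ℝ) 1, g x y ∈ Set.Icc (0:ℝ) 1)
    (hanti : ∀ x ∈ Set.Icc (0:ℝ) 1, AntitoneOn (fun y => g x y) (Set.Icc 0 1))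
    (hdery : ∀ x ∈ Set.Icc (0:ℝ) 1, ∀ y ∈ Set.Icc (0:ℝ) 1,
      HasDerivWithinAt (fun y' => g x y') (gy x y) (Set.Icc 0 1) y)
    (hC4 : ∀ x ∈ Set.Icc (0:ℝ) 1, ∀ y ∈ Set.Icc (0:ℝ) 1, g x y - 1 ≤ gy x y) :
    ∀ x ∈ Set.Icc (0:ℝ) 1, ∀ y ∈ Set.Icc (0:ℝ) 1, ∀ y' ∈ Set.Icc (0:ℝ) 1,
      |g x y - g x y'| ≤ |y - y'| := by
  intro x hx
  have hm : MonotoneOn (fun y => g x y + y) (Set.Icc 0 1) := by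
    refine monotoneOn_of_hasDerivWithinAt_nonneg (f' := fun y => gy x y + 1)
      (convex_Icc 0 1) ?_ ?_ ?_
    · intro y hy
      exact ((hdery x hx y hy).continuousWithinAt).add continuousWithinAt_id
    · intro y hy
      exact ((hdery x hx y (interior_subset hy)).mono interior_subset).add
        (hasDerivWithinAt_id _ _)
    · intro y hy
      have h1 := hC4 x hx y (interior_subset hy)
      have h2 := (hrange x hx y (interior_subset hy)).1
      linarith
  intro y hy y' hy'
  rcases le_total y y' with h | h
  · have h1 := hm hy hy' h
    have h2 := hanti x hx hy hy' h
    simp only at h1 h2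
    rw [abs_of_nonneg (by linarith), abs_of_nonpos (by linarith)]
    linarith
  · have h1 := hm hy' hy h
    have h2 := hanti x hx hy' hy h
    simp only at h1 h2
    rw [abs_of_nonpos (by linarith), abs_of_nonneg (by linarith)]
    linarith

theorem aux_int (g : ℝ → ℝ → ℝ)
    (hcont : ContinuousOn (Function.uncurry g) (Set.Icc 0 1 ×ˢ Set.Icc 0 1))
    {a b y : ℝ} (ha : 0 ≤ a) (hab : a ≤ b) (hb : b ≤ 1) (hy : y ∈ Set.Icc (0:ℝ) 1) :
    IntervalIntegrable (fun x => g x y) volume a b := by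
  apply ContinuousOn.intervalIntegrable
  rw [Set.uIcc_of_le hab]
  refine hcont.comp (f := fun x => (x, y)) (by fun_prop) ?_
  intro x hx
  exact ⟨⟨ha.trans hx.1, hx.2.trans hb⟩, hy⟩

theorem aux_intlip (g : ℝ → ℝ → ℝ)
    (hcont : ContinuousOn (Function.uncurry g) (Set.Icc 0 1 ×ˢ Set.Icc 0 1))
    (hlip : ∀ x ∈ Set.Icc (0:ℝ) 1, ∀ y ∈ Set.Icc (0:ℝ) 1, ∀ y' ∈ Set.Icc (0:ℝ) 1,
      |g x y - g x y'| ≤ |y - y'|)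
    {a b y y' : ℝ} (ha : 0 ≤ a) (hab : a ≤ b) (hb : b ≤ 1) (hy : y ∈ Set.Icc (0:ℝ) 1)
    (hy' : y' ∈ Set.Icc (0:ℝ) 1) :
    |(∫ x in a..b, g x y) - ∫ x in a..b, g x y'| ≤ |y - y'| * (b - a) := by
  rw [← intervalIntegral.integral_sub (aux_int g hcont ha hab hb hy)
    (aux_int g hcont ha hab hb hy')]
  have := intervalIntegral.norm_integral_le_of_norm_le_const (a := a) (b := b)
    (f := fun x => g x y - g x y') (C := |y - y'|) (by
      intro x hx
      rw [Set.uIoc_of_le hab] at hx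
      exact hlip x ⟨ha.trans hx.1.le, hx.2.trans hb⟩ y hy y' hy')
  rwa [abs_of_nonneg (sub_nonneg.2 hab)] at this

theorem aux_intbd (g : ℝ → ℝ → ℝ)
    (hcont : ContinuousOn (Function.uncurry g) (Set.Icc 0 1 ×ˢ Set.Icc 0 1))
    (hrange : ∀ x ∈ Set.Icc (0:ℝ) 1, ∀ y ∈ Set.Icc (0:ℝ) 1, g x y ∈ Set.Icc (0:ℝ) 1)
    {a b y : ℝ} (ha : 0 ≤ a) (hab : a ≤ b) (hb : b ≤ 1) (hy : y ∈ Set.Icc (0:ℝ) 1) :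
    0 ≤ (∫ x in a..b, g x y) ∧ (∫ x in a..b, g x y) ≤ b - a := by
  constructor
  · apply intervalIntegral.integral_nonneg hab
    intro x hx
    exact (hrange x ⟨ha.trans hx.1, hx.2.trans hb⟩ y hy).1
  · have := intervalIntegral.integral_mono_on hab (aux_int g hcont ha hab hb hy)
      (intervalIntegrable_const (c := (1:ℝ))) (fun x hx =>
        (hrange x ⟨ha.trans hx.1, hx.2.trans hb⟩ y hy).2)
    simpa using this

theorem stmt7 (g gx gy : ℝ → ℝ → ℝ)
    (hcont : ContinuousOn (Function.uncurry g) (Set.Icc 0 1 ×ˢ Set.Icc 0 1))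
    (hrange : ∀ x ∈ Set.Icc (0:ℝ) 1, ∀ y ∈ Set.Icc (0:ℝ) 1, g x y ∈ Set.Icc (0:ℝ) 1)
    (hmono : ∀ y ∈ Set.Icc (0:ℝ) 1, MonotoneOn (fun x => g x y) (Set.Icc 0 1))
    (hanti : ∀ x ∈ Set.Icc (0:ℝ) 1, AntitoneOn (fun y => g x y) (Set.Icc 0 1))
    (hderx : ∀ x ∈ Set.Icc (0:ℝ) 1, ∀ y ∈ Set.Icc (0:ℝ) 1,
      HasDerivWithinAt (fun x' => g x' y) (gx x y) (Set.Icc 0 1) x)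
    (hC3 : ∀ x ∈ Set.Icc (0:ℝ) 1, ∀ y ∈ Set.Icc (0:ℝ) 1, gx x y ≤ g x y)
    (hdery : ∀ x ∈ Set.Icc (0:ℝ) 1, ∀ y ∈ Set.Icc (0:ℝ) 1,
      HasDerivWithinAt (fun y' => g x y') (gy x y) (Set.Icc 0 1) y)
    (hC4 : ∀ x ∈ Set.Icc (0:ℝ) 1, ∀ y ∈ Set.Icc (0:ℝ) 1, g x y - 1 ≤ gy x y)
    :
    ∀ γ ∈ Set.Icc (0:ℝ) 1, ∀ τ ∈ Set.Icc (0:ℝ) 1, ∀ τ' ∈ Set.Icc (0:ℝ) 1,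
      |fFun g γ τ - fFun g γ τ'| ≤ 3 * |τ - τ'| := by
  have hlip := aux_lip_s7 g gy hrange hanti hdery hC4
  intro γ hγ
  have hnn : ∀ τ ∈ Set.Icc (0:ℝ) 1, ∀ y ∈ Set.Icc (0:ℝ) 1, ∀ θ ∈ Set.Icc (0:ℝ) γ,
      0 ≤ hFun g γ τ θ y := by
    intro τ hτ y hy θ hθ
    have h1 := (hrange θ ⟨hθ.1, hθ.2.trans hγ.2⟩ y hy).2
    have h2 := (aux_intbd g hcont hrange le_rfl hθ.1 (hθ.2.trans hγ.2) hy).1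
    have h3 := (aux_intbd g hcont hrange hθ.1 hθ.2 hγ.2 hτ).1
    unfold hFun
    linarith
  have hh : ∀ τ ∈ Set.Icc (0:ℝ) 1, ∀ y ∈ Set.Icc (0:ℝ) 1, ∀ τ' ∈ Set.Icc (0:ℝ) 1,
      ∀ y' ∈ Set.Icc (0:ℝ) 1, ∀ θ ∈ Set.Icc (0:ℝ) γ,
      hFun g γ τ θ y ≤ hFun g γ τ' θ y' + (2 * |y - y'| + |τ - τ'|) := by
    intro τ hτ y hy τ' hτ' y' hy' θ hθ
    have h1 := hlip θ ⟨hθ.1, hθ.2.trans hγ.2⟩ y hy y' hy'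
    have h2 := aux_intlip g hcont hlip le_rfl hθ.1 (hθ.2.trans hγ.2) hy hy'
    have h3 := aux_intlip g hcont hlip hθ.1 hθ.2 hγ.2 hτ hτ'
    have h4 : |y - y'| * (θ - 0) ≤ |y - y'| :=
      mul_le_of_le_one_right (abs_nonneg _) (by linarith [hθ.2, hγ.2])
    have h5 : |τ - τ'| * (γ - θ) ≤ |τ - τ'| :=
      mul_le_of_le_one_right (abs_nonneg _) (by linarith [hθ.1, hγ.2])
    unfold hFun
    rw [abs_le] at h1
    have h2' := (abs_le.1 (h2.trans h4)).2
    have h3' := (abs_le.1 (h3.trans h5)).2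
    linarith [h1.1]
  have hbdd : ∀ τ ∈ Set.Icc (0:ℝ) 1, ∀ y ∈ Set.Icc (0:ℝ) 1,
      BddBelow ((fun θ => hFun g γ τ θ y) '' Set.Icc 0 γ) := by
    intro τ hτ y hy
    refine ⟨0, ?_⟩
    rintro _ ⟨θ, hθ, rfl⟩
    exact hnn τ hτ y hy θ hθ
  have hne : ∀ τ y : ℝ, ((fun θ => hFun g γ τ θ y) '' Set.Icc 0 γ).Nonempty := fun τ y =>
    (Set.nonempty_Icc.2 hγ.1).image _
  have hq0 : ∀ τ ∈ Set.Icc (0:ℝ) 1, ∀ y ∈ Set.Icc (0:ℝ) 1, 0 ≤ qFun g γ τ y := by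
    intro τ hτ y hy
    apply le_csInf (hne τ y)
    rintro _ ⟨θ, hθ, rfl⟩
    exact hnn τ hτ y hy θ hθ
  have hq2 : ∀ τ ∈ Set.Icc (0:ℝ) 1, ∀ y ∈ Set.Icc (0:ℝ) 1, qFun g γ τ y ≤ 2 := by
    intro τ hτ y hy
    refine (csInf_le (hbdd τ hτ y hy) ⟨0, ⟨le_rfl, hγ.1⟩, rfl⟩).trans ?_
    have h1 := (hrange 0 ⟨le_rfl, zero_le_one⟩ y hy).1
    have h3 := (aux_intbd g hcont hrange le_rfl hγ.1 hγ.2 hτ).2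
    simp only [hFun, intervalIntegral.integral_same]
    linarith [hγ.2]
  have hql : ∀ τ ∈ Set.Icc (0:ℝ) 1, ∀ y ∈ Set.Icc (0:ℝ) 1, ∀ τ' ∈ Set.Icc (0:ℝ) 1,
      ∀ y' ∈ Set.Icc (0:ℝ) 1,
      qFun g γ τ y ≤ qFun g γ τ' y' + (2 * |y - y'| + |τ - τ'|) := by
    intro τ hτ y hy τ' hτ' y' hy'
    rw [← sub_le_iff_le_add]
    apply le_csInf (hne τ' y')
    rintro _ ⟨θ, hθ, rfl⟩
    have h1 : qFun g γ τ y ≤ hFun g γ τ θ y := csInf_le (hbdd τ hτ y hy) ⟨θ, hθ, rfl⟩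
    have h2 := hh τ hτ y hy τ' hτ' y' hy' θ hθ
    simp only
    linarith
  have hqc : ∀ τ ∈ Set.Icc (0:ℝ) 1, ContinuousOn (fun y => qFun g γ τ y) (Set.Icc 0 1) := by
    intro τ hτ
    refine LipschitzOnWith.continuousOn (K := 2) (LipschitzOnWith.of_dist_le_mul ?_)
    intro y hy y' hy'
    have h1 := hql τ hτ y hy τ hτ y' hy'
    have h2 := hql τ hτ y' hy' τ hτ y hy
    rw [abs_sub_comm y' y] at h2
    simp only [sub_self, abs_zero, add_zero] at h1 h2
    rw [Real.dist_eq, Real.dist_eq, abs_le]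
    constructor <;> simp only [NNReal.coe_ofNat] <;> linarith
  have hqi : ∀ τ ∈ Set.Icc (0:ℝ) 1, ∀ a b : ℝ, 0 ≤ a → a ≤ b → b ≤ 1 →
      IntervalIntegrable (fun y => qFun g γ τ y) volume a b := by
    intro τ hτ a b ha hab hb
    apply ContinuousOn.intervalIntegrable
    rw [Set.uIcc_of_le hab]
    exact (hqc τ hτ).mono (Set.Icc_subset_Icc ha hb)
  have key : ∀ τ ∈ Set.Icc (0:ℝ) 1, ∀ τ' ∈ Set.Icc (0:ℝ) 1, τ ≤ τ' →
      |fFun g γ τ - fFun g γ τ'| ≤ 3 * |τ - τ'| := by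
    intro τ hτ τ' hτ' hle
    have hI := aux_intbd g hcont hrange le_rfl hγ.1 hγ.2 hτ'
    have hIl := aux_intlip g hcont hlip le_rfl hγ.1 hγ.2 hτ hτ'
    have hIm : (∫ x in (0:ℝ)..γ, g x τ') ≤ ∫ x in (0:ℝ)..γ, g x τ :=
      intervalIntegral.integral_mono_on hγ.1 (aux_int g hcont le_rfl hγ.1 hγ.2 hτ')
        (aux_int g hcont le_rfl hγ.1 hγ.2 hτ)
        (fun x hx => hanti x ⟨hx.1, hx.2.trans hγ.2⟩ hτ hτ' hle)
    have hd : |τ - τ'| = τ' - τ := by rw [abs_of_nonpos (by linarith)]; ring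
    have hsplit := intervalIntegral.integral_add_adjacent_intervals
      (hqi τ' hτ' 0 τ le_rfl hτ.1 hτ.2) (hqi τ' hτ' τ τ' hτ.1 hle hτ'.2)
    have hA : |(∫ y in (0:ℝ)..τ, qFun g γ τ y) - ∫ y in (0:ℝ)..τ, qFun g γ τ' y|
        ≤ (τ' - τ) * τ := by
      rw [← intervalIntegral.integral_sub (hqi τ hτ 0 τ le_rfl hτ.1 hτ.2)
        (hqi τ' hτ' 0 τ le_rfl hτ.1 hτ.2)]
      have := intervalIntegral.norm_integral_le_of_norm_le_const (a := 0) (b := τ)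
        (f := fun y => qFun g γ τ y - qFun g γ τ' y) (C := τ' - τ) (by
          intro y hy
          rw [Set.uIoc_of_le hτ.1] at hy
          have hy1 : y ∈ Set.Icc (0:ℝ) 1 := ⟨hy.1.le, hy.2.trans hτ.2⟩
          have h1 := hql τ hτ y hy1 τ' hτ' y hy1
          have h2 := hql τ' hτ' y hy1 τ hτ y hy1
          rw [abs_sub_comm τ' τ] at h2
          rw [hd] at h1 h2
          simp only [sub_self, abs_zero, mul_zero, zero_add] at h1 h2
          rw [Real.norm_eq_abs, abs_le]
          constructor <;> linarith)
      rwa [sub_zero, abs_of_nonneg hτ.1] at this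
    have hB0 : 0 ≤ ∫ y in τ..τ', qFun g γ τ' y := by
      apply intervalIntegral.integral_nonneg hle
      intro y hy
      exact hq0 τ' hτ' y ⟨hτ.1.trans hy.1, hy.2.trans hτ'.2⟩
    have hB2 : (∫ y in τ..τ', qFun g γ τ' y) ≤ (τ' - τ) * 2 := by
      have := intervalIntegral.integral_mono_on hle (hqi τ' hτ' τ τ' hτ.1 hle hτ'.2)
        (intervalIntegrable_const (c := (2:ℝ))) (fun y hy =>
          hq2 τ' hτ' y ⟨hτ.1.trans hy.1, hy.2.trans hτ'.2⟩)
      simpa using this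
    rw [hd] at hIl ⊢
    unfold fFun pFun
    rw [← hsplit]
    generalize (∫ x in (0:ℝ)..γ, g x τ) = I at *
    generalize (∫ x in (0:ℝ)..γ, g x τ') = I' at *
    generalize (∫ y in τ..τ', qFun g γ τ' y) = B at *
    generalize (∫ y in (0:ℝ)..τ, qFun g γ τ y) = A at *
    generalize (∫ y in (0:ℝ)..τ, qFun g γ τ' y) = A' at *
    obtain ⟨hA1, hA2⟩ := abs_le.1 hA
    have hI2 : I - I' ≤ τ' - τ := by
      have := (abs_le.1 hIl).2
      have h4 : (τ' - τ) * (γ - 0) ≤ τ' - τ :=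
        mul_le_of_le_one_right (by linarith) (by linarith [hγ.2])
      linarith
    have hp : (1 - γ) * (1 - τ) + (1 - τ) * I - ((1 - γ) * (1 - τ') + (1 - τ') * I')
        = (τ' - τ) * (1 - γ + I') + (1 - τ) * (I - I') := by ring
    have e1 : 0 ≤ (τ' - τ) * (1 - γ + I') :=
      mul_nonneg (by linarith) (by linarith [hγ.2, hI.1])
    have e2 : (τ' - τ) * (1 - γ + I') ≤ τ' - τ :=
      mul_le_of_le_one_right (by linarith) (by linarith [hI.2])
    have e3 : 0 ≤ (1 - τ) * (I - I') := mul_nonneg (by linarith [hτ.2]) (by linarith)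
    have e4 : (1 - τ) * (I - I') ≤ (1 - τ) * (τ' - τ) :=
      mul_le_mul_of_nonneg_left hI2 (by linarith [hτ.2])
    have e5 : (τ' - τ) * τ ≤ τ' - τ := mul_le_of_le_one_right (by linarith) hτ.2
    rw [abs_le]
    constructor <;> linarith
  intro τ hτ τ' hτ'
  rcases le_total τ τ' with h | h
  · exact key τ hτ τ' hτ' h
  · rw [abs_sub_comm, abs_sub_comm τ τ']
    exact key τ' hτ' τ hτ h
end

section
/- (Lemma 5.2.) Let g satisfy conditions (C1)–(C4), let m be a positive integer, and set x_k = y_k = k/m for integers k. Fix γ, τ ∈ [0,1) and let i = ⌊mγ⌋ and j = ⌊mτ⌋, so that x_i ≤ γ < x_{i+1} and y_j ≤ τ < y_{j+1}. Define p̂(γ,τ) = (1−γ)(1−τ) + (1−τ)·(1/m)·∑_{k=0}^{i−1} g(x_k,τ), q̂(γ,τ,y) = min over integers 0 ≤ k ≤ i+1 of { 1 − g(x_k,y) + (1/m)∑_{d=0}^{k−1} g(x_d,y) + (1/m)∑_{d=k}^{i−1} g(x_d, y_{j+1}) }, and f̂(γ,τ) = p̂(γ,τ) + (1/m)∑_{k=0}^{j−1}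 (q̂(γ,τ,y_k) + q̂(γ,τ,y_{k+1}))/2. Then f̂(γ,τ) ≤ f(γ,τ) + 5/(4m). -/
open Set MeasureTheory

noncomputable def pHat (g : ℝ → ℝ → ℝ) (m : ℕ) (γ τ : ℝ) : ℝ :=
  (1 - γ) * (1 - τ) + (1 - τ) *
    ((1 / (m:ℝ)) * ∑ k ∈ Finset.range ⌊(m:ℝ) * γ⌋₊, g ((k:ℝ) / m) τ)

noncomputable def qHat (g : ℝ → ℝ → ℝ) (m : ℕ) (γ τ y : ℝ) : ℝ :=
  (Finset.range (⌊(m:ℝ) * γ⌋₊ + 2)).inf' (by simp) fun k =>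
    1 - g ((k:ℝ) / m) y + (1 / (m:ℝ)) * (∑ d ∈ Finset.range k, g ((d:ℝ) / m) y)
      + (1 / (m:ℝ)) * ∑ d ∈ Finset.Ico k ⌊(m:ℝ) * γ⌋₊,
          g ((d:ℝ) / m) (((⌊(m:ℝ) * τ⌋₊ : ℕ) + 1 : ℝ) / m)

noncomputable def fHat (g : ℝ → ℝ → ℝ) (m : ℕ) (γ τ : ℝ) : ℝ :=
  pHat g m γ τ + (1 / (m:ℝ)) * ∑ k ∈ Finset.range ⌊(m:ℝ) * τ⌋₊,
    (qHat g m γ τ ((k:ℝ) / m) + qHat g m γ τ (((k:ℝ) + 1) / m)) / 2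

lemma aux_int_s9 {φ : ℝ → ℝ} (h : MonotoneOn φ (Icc 0 1)) {a b : ℝ}
    (ha : a ∈ Icc (0:ℝ) 1) (hb : b ∈ Icc (0:ℝ) 1) : IntervalIntegrable φ volume a b := by
  apply MonotoneOn.intervalIntegrable
  exact h.mono (uIcc_subset_Icc ha hb)

lemma aux_nonneg {φ : ℝ → ℝ} (h0 : ∀ x ∈ Icc (0:ℝ) 1, 0 ≤ φ x) {a b : ℝ}
    (ha : 0 ≤ a) (hab : a ≤ b) (hb : b ≤ 1) : 0 ≤ ∫ x in a..b, φ x :=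
  intervalIntegral.integral_nonneg hab fun x hx => h0 x ⟨ha.trans hx.1, hx.2.trans hb⟩

lemma aux_div {m n : ℕ} (hm : 0 < m) (h : n ≤ m) : (n:ℝ) / m ∈ Icc (0:ℝ) 1 := by
  have : (0:ℝ) < m := by exact_mod_cast hm
  have h' : (n:ℝ) ≤ m := by exact_mod_cast h
  exact ⟨by positivity, by rw [div_le_one this]; exact h'⟩

lemma aux_sum {φ : ℝ → ℝ} (h : MonotoneOn φ (Icc 0 1)) {m : ℕ} (hm : 0 < m) {a b : ℕ}
    (hab : a ≤ b) (hb : b ≤ m) :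
    (1 / (m:ℝ)) * ∑ d ∈ Finset.Ico a b, φ ((d:ℝ) / m) ≤ ∫ x in ((a:ℝ)/m)..((b:ℝ)/m), φ x := by
  have hm' : (0:ℝ) < m := by exact_mod_cast hm
  induction b, hab using Nat.le_induction with
  | base => simp
  | succ n hn ih =>
    have ih := ih (by omega)
    rw [Finset.sum_Ico_succ_top hn, mul_add]
    have hA := aux_div hm (show a ≤ m by omega)
    have hN := aux_div hm (show n ≤ m by omega)
    have hS := aux_div hm hb
    rw [← intervalIntegral.integral_add_adjacent_intervals (aux_int_s9 h hA hN) (aux_int_s9 h hN hS)]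
    have hle : (n:ℝ) / m ≤ ((n+1 : ℕ):ℝ) / m := by
      gcongr; simp
    have : ∫ x in ((n:ℝ)/m)..(((n+1:ℕ):ℝ)/m), φ ((n:ℝ)/m) ≤ ∫ x in ((n:ℝ)/m)..(((n+1:ℕ):ℝ)/m), φ x := by
      apply intervalIntegral.integral_mono_on hle (by simp) (aux_int_s9 h hN hS)
      intro x hx
      exact h hN ⟨hN.1.trans hx.1, hx.2.trans hS.2⟩ hx.1
    rw [intervalIntegral.integral_const, smul_eq_mul] at this
    have e : ((n+1:ℕ):ℝ)/m - (n:ℝ)/m = 1 / m := by push_cast; ring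
    rw [e] at this
    linarith

lemma aux_trap {q : ℝ → ℝ} {a b : ℝ} (hab : a ≤ b)
    (hq : ∀ y ∈ Icc a b, ∀ z ∈ Icc a b, q y ≤ q z + |y - z|)
    (hi : ∀ c ∈ Icc a b, ∀ d ∈ Icc a b, IntervalIntegrable q volume c d) :
    (b - a) * ((q a + q b) / 2) - (b - a)^2 / 4 ≤ ∫ x in a..b, q x := by
  set c := (a + b) / 2 with hc
  have hac : a ≤ c := by linarith
  have hcb : c ≤ b := by linarith
  have ma : a ∈ Icc a b := ⟨le_rfl, hab⟩
  have mb : b ∈ Icc a b := ⟨hab, le_rfl⟩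
  have mc : c ∈ Icc a b := ⟨hac, hcb⟩
  rw [← intervalIntegral.integral_add_adjacent_intervals (hi a ma c mc) (hi c mc b mb)]
  have h1 : ∫ x in a..c, (q a + a - x) ≤ ∫ x in a..c, q x := by
    apply intervalIntegral.integral_mono_on hac
      (Continuous.intervalIntegrable (by fun_prop) _ _) (hi a ma c mc)
    intro x hx
    have := hq a ma x ⟨hx.1, hx.2.trans hcb⟩
    rw [abs_of_nonpos (by linarith [hx.1])] at this
    linarith
  have h2 : ∫ x in c..b, (q b - b + x) ≤ ∫ x in c..b, q x := by
    apply intervalIntegral.integral_mono_on hcb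
      (Continuous.intervalIntegrable (by fun_prop) _ _) (hi c mc b mb)
    intro x hx
    have := hq b mb x ⟨hac.trans hx.1, hx.2⟩
    rw [abs_of_nonneg (by linarith [hx.2])] at this
    linarith
  rw [intervalIntegral.integral_sub (by simp) (Continuous.intervalIntegrable (by fun_prop) _ _),
    intervalIntegral.integral_const, integral_id, smul_eq_mul] at h1
  rw [intervalIntegral.integral_add (by simp) (Continuous.intervalIntegrable (by fun_prop) _ _),
    intervalIntegral.integral_const, integral_id, smul_eq_mul] at h2
  have e1 : (c - a) * (q a + a) - (c^2 - a^2)/2 + ((b - c) * (q b - b) + (b^2 - c^2)/2)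
      = (b - a) * ((q a + q b) / 2) - (b - a)^2 / 4 := by
    rw [hc]; ring
  linarith

theorem stmt9 (g gx gy : ℝ → ℝ → ℝ)
    (hcont : ContinuousOn (Function.uncurry g) (Set.Icc 0 1 ×ˢ Set.Icc 0 1))
    (hrange : ∀ x ∈ Set.Icc (0:ℝ) 1, ∀ y ∈ Set.Icc (0:ℝ) 1, g x y ∈ Set.Icc (0:ℝ) 1)
    (hmono : ∀ y ∈ Set.Icc (0:ℝ) 1, MonotoneOn (fun x => g x y) (Set.Icc 0 1))
    (hanti : ∀ x ∈ Set.Icc (0:ℝ) 1, AntitoneOn (fun y => g x y) (Set.Icc 0 1))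
    (hderx : ∀ x ∈ Set.Icc (0:ℝ) 1, ∀ y ∈ Set.Icc (0:ℝ) 1,
      HasDerivWithinAt (fun x' => g x' y) (gx x y) (Set.Icc 0 1) x)
    (hC3 : ∀ x ∈ Set.Icc (0:ℝ) 1, ∀ y ∈ Set.Icc (0:ℝ) 1, gx x y ≤ g x y)
    (hdery : ∀ x ∈ Set.Icc (0:ℝ) 1, ∀ y ∈ Set.Icc (0:ℝ) 1,
      HasDerivWithinAt (fun y' => g x y') (gy x y) (Set.Icc 0 1) y)
    (hC4 : ∀ x ∈ Set.Icc (0:ℝ) 1, ∀ y ∈ Set.Icc (0:ℝ) 1, g x y - 1 ≤ gy x y)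
    (m : ℕ) (hm : 0 < m) (γ τ : ℝ) (hγ : γ ∈ Set.Ico (0:ℝ) 1) (hτ : τ ∈ Set.Ico (0:ℝ) 1) :
    fHat g m γ τ ≤ fFun g γ τ + 5 / (4 * m) := by
  have hm' : (0:ℝ) < m := by exact_mod_cast hm
  obtain ⟨hγ0, hγ1⟩ := hγ
  obtain ⟨hτ0, hτ1⟩ := hτ
  set i := ⌊(m:ℝ) * γ⌋₊ with hi
  set j := ⌊(m:ℝ) * τ⌋₊ with hj
  have hiγ : (i:ℝ) / m ≤ γ := by
    rw [div_le_iff₀ hm', mul_comm]; exact Nat.floor_le (by positivity)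
  have hjτ : (j:ℝ) / m ≤ τ := by
    rw [div_le_iff₀ hm', mul_comm]; exact Nat.floor_le (by positivity)
  have hτj : τ ≤ ((j:ℝ) + 1) / m := by
    rw [le_div_iff₀ hm', mul_comm]; exact (Nat.lt_floor_add_one _).le
  have him : i + 1 ≤ m := by
    have : i < m := (Nat.floor_lt (by positivity)).2 (by nlinarith)
    omega
  have hjm : j + 1 ≤ m := by
    have : j < m := (Nat.floor_lt (by positivity)).2 (by nlinarith)
    omega
  have hτI : τ ∈ Icc (0:ℝ) 1 := ⟨hτ0, hτ1.le⟩
  have hγI : γ ∈ Icc (0:ℝ) 1 := ⟨hγ0, hγ1.le⟩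
  have h0I : (0:ℝ) ∈ Icc (0:ℝ) 1 := by simp
  have hjI : ((j:ℝ) + 1) / m ∈ Icc (0:ℝ) 1 := by
    have := aux_div hm hjm
    push_cast at this; exact this
  have hII : ∀ y ∈ Icc (0:ℝ) 1, ∀ a ∈ Icc (0:ℝ) 1, ∀ b ∈ Icc (0:ℝ) 1,
      IntervalIntegrable (fun x => g x y) volume a b :=
    fun y hy a ha b hb => aux_int_s9 (hmono y hy) ha hb
  have hg0 : ∀ y ∈ Icc (0:ℝ) 1, ∀ x ∈ Icc (0:ℝ) 1, 0 ≤ g x y := fun y hy x hx => (hrange x hx y hy).1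
  -- Lipschitz in y
  have hlip : ∀ x ∈ Icc (0:ℝ) 1, ∀ y ∈ Icc (0:ℝ) 1, ∀ z ∈ Icc (0:ℝ) 1, y ≤ z →
      g x y + y ≤ g x z + z := by
    intro x hx y hy z hz hyz
    have hM : MonotoneOn (fun y => g x y + y) (Icc 0 1) := by
      apply monotoneOn_of_hasDerivWithinAt_nonneg (f' := fun y => gy x y + 1) (convex_Icc 0 1)
      · intro w hw
        exact ((hdery x hx w hw).add (hasDerivWithinAt_id w _)).continuousWithinAt
      · intro w hw
        exact ((hdery x hx w (interior_subset hw)).add (hasDerivWithinAt_id w _)).mono interior_subset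
      · intro w hw
        have hw := interior_subset hw
        have := hC4 x hx w hw
        have := (hrange x hx w hw).1
        linarith
    exact hM hy hz hyz
  have hh0 : ∀ y ∈ Icc (0:ℝ) 1, ∀ θ ∈ Icc 0 γ, 0 ≤ hFun g γ τ θ y := by
    intro y hy θ hθ
    unfold hFun
    have hθI : θ ∈ Icc (0:ℝ) 1 := ⟨hθ.1, hθ.2.trans hγ1.le⟩
    have h1 := (hrange θ hθI y hy).2
    have h2 := aux_nonneg (hg0 y hy) le_rfl hθ.1 hθI.2
    have h3 := aux_nonneg (hg0 τ hτI) hθ.1 hθ.2 hγ1.le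
    linarith
  have hne : ∀ y, ((fun θ => hFun g γ τ θ y) '' Set.Icc 0 γ).Nonempty :=
    fun y => ⟨_, 0, ⟨le_rfl, hγ0⟩, rfl⟩
  have hbd : ∀ y ∈ Icc (0:ℝ) 1, BddBelow ((fun θ => hFun g γ τ θ y) '' Set.Icc 0 γ) := by
    intro y hy
    refine ⟨0, ?_⟩
    rintro _ ⟨θ, hθ, rfl⟩
    exact hh0 y hy θ hθ
  have hq0 : ∀ y ∈ Icc (0:ℝ) 1, 0 ≤ qFun g γ τ y := by
    intro y hy
    apply le_csInf (hne y)
    rintro _ ⟨θ, hθ, rfl⟩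
    exact hh0 y hy θ hθ
  have hqlip : ∀ y ∈ Icc (0:ℝ) 1, ∀ z ∈ Icc (0:ℝ) 1,
      qFun g γ τ y ≤ qFun g γ τ z + |y - z| := by
    intro y hy z hz
    rw [← sub_le_iff_le_add]
    apply le_csInf (hne z)
    rintro _ ⟨θ, hθ, rfl⟩
    rw [sub_le_iff_le_add]
    have h1 : qFun g γ τ y ≤ hFun g γ τ θ y := csInf_le (hbd y hy) ⟨θ, hθ, rfl⟩
    refine h1.trans ?_
    have hθI : θ ∈ Icc (0:ℝ) 1 := ⟨hθ.1, hθ.2.trans hγ1.le⟩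
    simp only [hFun]
    rcases le_total y z with hyz | hyz
    · have a1 := hanti θ hθI hy hz hyz
      have a2 : ∫ x in (0:ℝ)..θ, g x y ≤ ∫ x in (0:ℝ)..θ, (g x z + (z - y)) := by
        apply intervalIntegral.integral_mono_on hθ.1 (hII y hy _ h0I _ hθI)
          ((hII z hz _ h0I _ hθI).add (by simp))
        intro x hx
        have := hlip x ⟨hx.1, hx.2.trans hθI.2⟩ y hy z hz hyz
        linarith
      rw [intervalIntegral.integral_add (hII z hz _ h0I _ hθI) (by simp),
        intervalIntegral.integral_const, smul_eq_mul] at a2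
      rw [abs_of_nonpos (by linarith)]
      have : (θ - 0) * (z - y) ≤ z - y := by nlinarith [hθI.2]
      simp only at a1
      linarith
    · have a1 := hlip θ hθI z hz y hy hyz
      have a2 : ∫ x in (0:ℝ)..θ, g x y ≤ ∫ x in (0:ℝ)..θ, g x z := by
        apply intervalIntegral.integral_mono_on hθ.1 (hII y hy _ h0I _ hθI)
          (hII z hz _ h0I _ hθI)
        intro x hx
        exact hanti x ⟨hx.1, hx.2.trans hθI.2⟩ hz hy hyz
      rw [abs_of_nonneg (by linarith)]
      linarith
  have hqI : ∀ a ∈ Icc (0:ℝ) 1, ∀ b ∈ Icc (0:ℝ) 1,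
      IntervalIntegrable (fun y => qFun g γ τ y) volume a b := by
    intro a ha b hb
    apply ContinuousOn.intervalIntegrable
    apply ContinuousOn.mono _ (uIcc_subset_Icc ha hb)
    have : LipschitzOnWith 1 (fun y => qFun g γ τ y) (Icc 0 1) := by
      apply LipschitzOnWith.of_le_add
      intro x hx y hy
      rw [Real.dist_eq]
      exact hqlip x hx y hy
    exact this.continuousOn
  -- q-hat bound
  have hqhat : ∀ y ∈ Icc (0:ℝ) 1, qHat g m γ τ y ≤ qFun g γ τ y + 1 / m := by
    intro y hy
    rw [← sub_le_iff_le_add]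
    apply le_csInf (hne y)
    rintro _ ⟨θ, hθ, rfl⟩
    rw [sub_le_iff_le_add]
    have hθI : θ ∈ Icc (0:ℝ) 1 := ⟨hθ.1, hθ.2.trans hγ1.le⟩
    set k := ⌊(m:ℝ) * θ⌋₊ with hk
    have hki : k ≤ i := Nat.floor_mono (by have := hθ.2; gcongr)
    have hkθ : (k:ℝ) / m ≤ θ := by
      rw [div_le_iff₀ hm', mul_comm]; exact Nat.floor_le (mul_nonneg hm'.le hθ.1)
    have hθk : θ ≤ ((k+1:ℕ):ℝ) / m := by
      rw [le_div_iff₀ hm', mul_comm]; push_cast; exact (Nat.lt_floor_add_one _).le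
    have hkI := aux_div hm (show k ≤ m by omega)
    have hk1I := aux_div hm (show k + 1 ≤ m by omega)
    have hq : qHat g m γ τ y ≤ 1 - g (((k+1:ℕ):ℝ) / m) y
        + (1 / (m:ℝ)) * (∑ d ∈ Finset.range (k+1), g ((d:ℝ) / m) y)
        + (1 / (m:ℝ)) * ∑ d ∈ Finset.Ico (k+1) i, g ((d:ℝ) / m) (((j : ℕ) + 1 : ℝ) / m) := by
      unfold qHat
      exact Finset.inf'_le _ (b := k + 1) (by simp; omega)
    refine hq.trans ?_
    simp only [hFun]
    have b1 : g θ y ≤ g (((k+1:ℕ):ℝ) / m) y := hmono y hy hθI hk1I hθk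
    have b2 : (1 / (m:ℝ)) * (∑ d ∈ Finset.range (k+1), g ((d:ℝ) / m) y)
        ≤ (∫ x in (0:ℝ)..θ, g x y) + 1 / m := by
      rw [Finset.sum_range_succ, mul_add]
      have c1 := aux_sum (hmono y hy) hm (Nat.zero_le k) (by omega)
      simp only [Nat.cast_zero, zero_div, Nat.Ico_zero_eq_range] at c1
      have c2 := intervalIntegral.integral_add_adjacent_intervals (hII y hy 0 h0I _ hkI)
        (hII y hy _ hkI θ hθI)
      have c3 := aux_nonneg (hg0 y hy) hkI.1 hkθ hθI.2
      have c4 : 1 / (m:ℝ) * g ((k:ℝ) / m) y ≤ 1 / m :=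
        mul_le_of_le_one_right (by positivity) (hrange _ hkI y hy).2
      linarith
    have b3 : (1 / (m:ℝ)) * ∑ d ∈ Finset.Ico (k+1) i, g ((d:ℝ) / m) (((j : ℕ) + 1 : ℝ) / m)
        ≤ ∫ x in θ..γ, g x τ := by
      rcases Nat.lt_or_ge k i with hlt | hge
      · have c0 : (1 / (m:ℝ)) * ∑ d ∈ Finset.Ico (k+1) i, g ((d:ℝ) / m) (((j : ℕ) + 1 : ℝ) / m)
            ≤ (1 / (m:ℝ)) * ∑ d ∈ Finset.Ico (k+1) i, g ((d:ℝ) / m) τ := by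
          gcongr with d hd
          rw [Finset.mem_Ico] at hd
          exact hanti _ (aux_div hm (by omega)) hτI hjI hτj
        have c1 := aux_sum (hmono τ hτI) hm (show k + 1 ≤ i by omega) (by omega)
        have hiI := aux_div hm (show i ≤ m by omega)
        have c2 := intervalIntegral.integral_add_adjacent_intervals (hII τ hτI θ hθI _ hk1I)
          (hII τ hτI _ hk1I γ hγI)
        have c3 := intervalIntegral.integral_add_adjacent_intervals (hII τ hτI _ hk1I _ hiI)
          (hII τ hτI _ hiI γ hγI)
        have c4 := aux_nonneg (hg0 τ hτI) hθ.1 hθk hk1I.2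
        have c5 := aux_nonneg (hg0 τ hτI) hiI.1 hiγ hγ1.le
        linarith
      · rw [Finset.Ico_eq_empty (by omega)]
        simp only [Finset.sum_empty, mul_zero]
        exact aux_nonneg (hg0 τ hτI) hθ.1 hθ.2 hγ1.le
    linarith
  have hp : pHat g m γ τ ≤ pFun g γ τ := by
    unfold pHat pFun
    have c1 := aux_sum (hmono τ hτI) hm (Nat.zero_le i) (by omega)
    simp only [Nat.cast_zero, zero_div, Nat.Ico_zero_eq_range] at c1
    have hiI := aux_div hm (show i ≤ m by omega)
    have c3 := intervalIntegral.integral_add_adjacent_intervals (hII τ hτI _ h0I _ hiI)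
          (hII τ hτI _ hiI γ hγI)
    have c5 := aux_nonneg (hg0 τ hτI) hiI.1 hiγ hγ1.le
    have : 0 ≤ 1 - τ := by linarith
    gcongr
    linarith
  have hsum : ∀ n : ℕ, n ≤ j → (1 / (m:ℝ)) * ∑ k ∈ Finset.range n,
      (qHat g m γ τ ((k:ℝ) / m) + qHat g m γ τ (((k:ℝ) + 1) / m)) / 2
      ≤ (∫ y in (0:ℝ)..((n:ℝ)/m), qFun g γ τ y) + n / m * (5 / (4 * m)) := by
    intro n
    induction n with
    | zero => simp
    | succ n ih =>
      intro hn
      have ih := ih (by omega)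
      have hN := aux_div hm (show n ≤ m by omega)
      have hS := aux_div hm (show n + 1 ≤ m by omega)
      have hle : (n:ℝ) / m ≤ ((n+1 : ℕ):ℝ) / m := by
        gcongr; simp
      have hsub : Icc ((n:ℝ)/m) (((n+1 : ℕ):ℝ) / m) ⊆ Icc 0 1 := Icc_subset_Icc hN.1 hS.2
      have t := aux_trap hle (fun y hy z hz => hqlip y (hsub hy) z (hsub hz))
        (fun y hy z hz => hqI y (hsub hy) z (hsub hz))
      have e : ((n+1:ℕ):ℝ)/m - (n:ℝ)/m = 1 / m := by push_cast; ring
      rw [e] at t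
      rw [Finset.sum_range_succ, mul_add,
        ← intervalIntegral.integral_add_adjacent_intervals (hqI _ h0I _ hN) (hqI _ hN _ hS)]
      have q1 := hqhat _ hN
      have q2 := hqhat _ hS
      have e2 : ((n+1:ℕ):ℝ)/m = ((n:ℝ)+1)/m := by push_cast; ring
      have q3 : 1 / (m:ℝ) * ((qHat g m γ τ ((n:ℝ) / m) + qHat g m γ τ (((n+1:ℕ):ℝ) / m)) / 2)
          ≤ 1 / (m:ℝ) * ((qFun g γ τ ((n:ℝ) / m) + qFun g γ τ (((n+1:ℕ):ℝ) / m)) / 2 + 1 / m) := by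
        gcongr
        linarith
      rw [e2] at q3 t ⊢
      have e3 : ((n:ℝ)+1)/m * (5 / (4 * m)) = n / m * (5 / (4*m)) + 1 / m * (1 / m) + (1/(m:ℝ))^2/4 := by
        field_simp; ring
      rw [e3]
      linarith
  have hs := hsum j le_rfl
  have hJ := aux_div hm (show j ≤ m by omega)
  have c1 := intervalIntegral.integral_add_adjacent_intervals (hqI 0 h0I _ hJ) (hqI _ hJ τ hτI)
  have c2 := aux_nonneg hq0 hJ.1 hjτ hτ1.le
  have c3 : (j:ℝ) / m * (5 / (4 * m)) ≤ 5 / (4 * m) := mul_le_of_le_one_left (by positivity) hJ.2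
  unfold fHat fFun
  linarith
end

section
/- (Corollary 5.3.) Let g satisfy conditions (C1)–(C4), let n and m be positive integers, and let F = {0, 1/n, 2/n, …, 1}² ∩ [0,1)² be the set of grid points of the n × n discretization of the unit square at which f̂ is defined. Then min over (γ,τ) ∈ F of f̂(γ,τ) ≤ (min over (γ,τ) ∈ [0,1]² of f(γ,τ)) + 2/n + 5/(4m), where f̂ is the discretized approximation of f with parameter m defined as follows: with x_k = y_k = k/m, i = ⌊mγ⌋, j = ⌊mτ⌋, set p̂(γ,τ) = (1−γ)(1−τ) + (1−τ)·(1/m)·∑_{k=0}^{i−1} g(x_k,τ), q̂(γ,τ,y) = min over integers 0 ≤ k ≤ i+1 of { 1 − g(x_k,y) + (1/m)∑_{d=0}^{k−1} g(x_d,y) + (1/m)∑_{d=k}^{i−1} g(x_d, y_{j+1}) }, and f̂(γ,τ) = p̂(γ,τ) + (1/m)∑_{k=0}^{j−1} (q̂(γ,τ,y_k) + q̂(γ,τ,y_{k+1}))/2. -/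
open Set MeasureTheory

structure Good (g : ℝ → ℝ → ℝ) : Prop where
  nonneg : ∀ x ∈ Icc (0:ℝ) 1, ∀ y ∈ Icc (0:ℝ) 1, 0 ≤ g x y
  le_one : ∀ x ∈ Icc (0:ℝ) 1, ∀ y ∈ Icc (0:ℝ) 1, g x y ≤ 1
  mono : ∀ y ∈ Icc (0:ℝ) 1, MonotoneOn (fun x => g x y) (Icc 0 1)
  anti : ∀ x ∈ Icc (0:ℝ) 1, AntitoneOn (fun y => g x y) (Icc 0 1)
  cont : ∀ y ∈ Icc (0:ℝ) 1, ContinuousOn (fun x => g x y) (Icc 0 1)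
  lipx : ∀ x ∈ Icc (0:ℝ) 1, ∀ x' ∈ Icc (0:ℝ) 1, ∀ y ∈ Icc (0:ℝ) 1, x ≤ x' →
    g x' y - g x y ≤ x' - x
  lipy : ∀ x ∈ Icc (0:ℝ) 1, ∀ y ∈ Icc (0:ℝ) 1, ∀ y' ∈ Icc (0:ℝ) 1, y ≤ y' →
    g x y - g x y' ≤ (y' - y) * (1 - g x y')

lemma mvt_le (φ φ' : ℝ → ℝ) (C a b : ℝ) (ha : 0 ≤ a) (hab : a ≤ b) (hb : b ≤ 1)
    (hd : ∀ x ∈ Icc (0:ℝ) 1, HasDerivWithinAt φ (φ' x) (Icc 0 1) x)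
    (hC : ∀ x ∈ Icc a b, φ' x ≤ C) : φ b - φ a ≤ C * (b - a) := by
  have hsub : Icc a b ⊆ Icc (0:ℝ) 1 := Icc_subset_Icc ha hb
  have hder : ∀ x ∈ interior (Icc a b), HasDerivAt φ (φ' x) x := by
    intro x hx
    rw [interior_Icc] at hx
    exact (hd x (hsub (Ioo_subset_Icc_self hx))).hasDerivAt
      (Icc_mem_nhds (lt_of_le_of_lt ha hx.1) (lt_of_lt_of_le hx.2 hb))
  refine (convex_Icc a b).image_sub_le_mul_sub_of_deriv_le
    (fun x hx => ((hd x (hsub hx)).continuousWithinAt).mono hsub)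
    (fun x hx => (hder x hx).differentiableAt.differentiableWithinAt)
    (fun x hx => ?_) a (left_mem_Icc.2 hab) b (right_mem_Icc.2 hab) hab
  rw [(hder x hx).deriv]
  exact hC x (interior_subset hx)

lemma Good.int {g : ℝ → ℝ → ℝ} (G : Good g) {y a b : ℝ} (hy : y ∈ Icc (0:ℝ) 1)
    (ha : a ∈ Icc (0:ℝ) 1) (hb : b ∈ Icc (0:ℝ) 1) :
    IntervalIntegrable (fun x => g x y) volume a b := by
  apply ContinuousOn.intervalIntegrable
  exact (G.cont y hy).mono (uIcc_subset_Icc ha hb)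

lemma Good.int_nonneg {g : ℝ → ℝ → ℝ} (G : Good g) {y a b : ℝ} (hy : y ∈ Icc (0:ℝ) 1)
    (ha : 0 ≤ a) (hab : a ≤ b) (hb : b ≤ 1) : 0 ≤ ∫ x in a..b, g x y :=
  intervalIntegral.integral_nonneg hab
    fun x hx => G.nonneg x ⟨ha.trans hx.1, hx.2.trans hb⟩ y hy

lemma Good.h_nonneg {g : ℝ → ℝ → ℝ} (G : Good g) {γ τ θ y : ℝ} (hγ : γ ≤ 1)
    (hτ : τ ∈ Icc (0:ℝ) 1) (hy : y ∈ Icc (0:ℝ) 1) (hθ : θ ∈ Icc 0 γ) : 0 ≤ hFun g γ τ θ y := by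
  have h1 := G.le_one θ ⟨hθ.1, hθ.2.trans hγ⟩ y hy
  have h2 := G.int_nonneg hy le_rfl hθ.1 (hθ.2.trans hγ)
  have h3 := G.int_nonneg hτ hθ.1 hθ.2 hγ
  unfold hFun
  linarith

lemma Good.q_le {g : ℝ → ℝ → ℝ} (G : Good g) {γ τ θ y : ℝ} (hγ : γ ≤ 1)
    (hτ : τ ∈ Icc (0:ℝ) 1) (hy : y ∈ Icc (0:ℝ) 1) (hθ : θ ∈ Icc 0 γ) :
    qFun g γ τ y ≤ hFun g γ τ θ y := by
  refine csInf_le ⟨0, ?_⟩ ⟨θ, hθ, rfl⟩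
  rintro _ ⟨t, ht, rfl⟩
  exact G.h_nonneg hγ hτ hy ht

lemma le_q {g : ℝ → ℝ → ℝ} {γ τ y c : ℝ} (hγ : 0 ≤ γ)
    (h : ∀ θ ∈ Icc 0 γ, c ≤ hFun g γ τ θ y) : c ≤ qFun g γ τ y := by
  refine le_csInf ⟨_, 0, ⟨le_rfl, hγ⟩, rfl⟩ ?_
  rintro _ ⟨t, ht, rfl⟩
  exact h t ht

lemma Good.q_nonneg {g : ℝ → ℝ → ℝ} (G : Good g) {γ τ y : ℝ} (hγ : γ ∈ Icc (0:ℝ) 1)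
    (hτ : τ ∈ Icc (0:ℝ) 1) (hy : y ∈ Icc (0:ℝ) 1) : 0 ≤ qFun g γ τ y :=
  le_q hγ.1 fun _ ht => G.h_nonneg hγ.2 hτ hy ht

lemma Good.q_lip {g : ℝ → ℝ → ℝ} (G : Good g) {γ τ y y' : ℝ} (hγ : γ ∈ Icc (0:ℝ) 1)
    (hτ : τ ∈ Icc (0:ℝ) 1) (hy : y ∈ Icc (0:ℝ) 1) (hy' : y' ∈ Icc (0:ℝ) 1) :
    qFun g γ τ y ≤ qFun g γ τ y' + |y - y'| := by
  rw [← sub_le_iff_le_add]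
  refine le_q hγ.1 fun θ hθ => ?_
  have hq := G.q_le hγ.2 hτ hy hθ
  have hθ1 : θ ∈ Icc (0:ℝ) 1 := ⟨hθ.1, hθ.2.trans hγ.2⟩
  have h0 : (0:ℝ) ∈ Icc (0:ℝ) 1 := by simp
  have i1 := G.int hy h0 hθ1
  have i2 := G.int hy' h0 hθ1
  unfold hFun at *
  rcases le_total y y' with h | h
  · have e1 := G.anti θ hθ1 hy hy' h
    have e2 : ∫ x in (0:ℝ)..θ, g x y ≤ ∫ x in (0:ℝ)..θ, (g x y' + (y' - y)) := by
      refine intervalIntegral.integral_mono_on hθ.1 i1 (i2.add (by simp)) fun x hx => ?_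
      have hx1 : x ∈ Icc (0:ℝ) 1 := ⟨hx.1, hx.2.trans hθ1.2⟩
      have := G.lipy x hx1 y hy y' hy' h
      have := G.nonneg x hx1 y' hy'
      nlinarith
    rw [intervalIntegral.integral_add i2 (by simp)] at e2
    simp only [intervalIntegral.integral_const, smul_eq_mul] at e2
    rw [abs_of_nonpos (by linarith)]
    have := hθ1.2
    simp only at e1
    nlinarith
  · have e1 := G.lipy θ hθ1 y' hy' y hy h
    have e2 : ∫ x in (0:ℝ)..θ, g x y ≤ ∫ x in (0:ℝ)..θ, g x y' := by
      refine intervalIntegral.integral_mono_on hθ.1 i1 i2 fun x hx => ?_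
      exact G.anti x ⟨hx.1, hx.2.trans hθ1.2⟩ hy' hy h
    rw [abs_of_nonneg (by linarith)]
    have := G.nonneg θ hθ1 y hy
    nlinarith

lemma lip_cont {Q : ℝ → ℝ}
    (hQ : ∀ s ∈ Icc (0:ℝ) 1, ∀ t ∈ Icc (0:ℝ) 1, Q s ≤ Q t + |s - t|) :
    ContinuousOn Q (Icc 0 1) := by
  have : LipschitzOnWith 1 Q (Icc 0 1) := by
    refine LipschitzOnWith.of_dist_le_mul fun s hs t ht => ?_
    have h1 := hQ s hs t ht
    have h2 := hQ t ht s hs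
    rw [abs_sub_comm t s] at h2
    simp only [Real.dist_eq, NNReal.coe_one, one_mul]
    exact abs_le.2 ⟨by linarith, by linarith⟩
  exact this.continuousOn

lemma lip_int {Q : ℝ → ℝ}
    (hQ : ∀ s ∈ Icc (0:ℝ) 1, ∀ t ∈ Icc (0:ℝ) 1, Q s ≤ Q t + |s - t|) {a b : ℝ}
    (ha : a ∈ Icc (0:ℝ) 1) (hb : b ∈ Icc (0:ℝ) 1) : IntervalIntegrable Q volume a b := by
  apply ContinuousOn.intervalIntegrable
  exact (lip_cont hQ).mono (uIcc_subset_Icc ha hb)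

lemma Good.q_int {g : ℝ → ℝ → ℝ} (G : Good g) {γ τ a b : ℝ} (hγ : γ ∈ Icc (0:ℝ) 1)
    (hτ : τ ∈ Icc (0:ℝ) 1) (ha : a ∈ Icc (0:ℝ) 1) (hb : b ∈ Icc (0:ℝ) 1) :
    IntervalIntegrable (fun y => qFun g γ τ y) volume a b :=
  lip_int (fun _ hs _ ht => G.q_lip hγ hτ hs ht) ha hb

lemma riemann {φ : ℝ → ℝ} (hφ : MonotoneOn φ (Icc 0 1)) (hc : ContinuousOn φ (Icc 0 1))
    {m : ℕ} (hm : 0 < m) {a b : ℕ} (hab : a ≤ b) (hb : (b:ℝ) / m ≤ 1) :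
    (1 / (m:ℝ)) * ∑ d ∈ Finset.Ico a b, φ ((d:ℝ) / m) ≤ ∫ x in ((a:ℝ)/m)..((b:ℝ)/m), φ x := by
  have hm' : (0:ℝ) < m := by exact_mod_cast hm
  induction b, hab using Nat.le_induction with
  | base => simp
  | succ b hab ih =>
    have hlt : (b:ℝ) / m ≤ ((b+1 : ℕ):ℝ) / m := by gcongr; norm_num
    have hb0 : (b:ℝ)/m ∈ Icc (0:ℝ) 1 := ⟨by positivity, hlt.trans hb⟩
    have hb1 : ((b+1:ℕ):ℝ)/m ∈ Icc (0:ℝ) 1 := ⟨by positivity, hb⟩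
    have ha0 : (a:ℝ)/m ∈ Icc (0:ℝ) 1 := by
      refine ⟨by positivity, le_trans ?_ hb0.2⟩
      gcongr
    have I : ∀ u ∈ Icc (0:ℝ) 1, ∀ v ∈ Icc (0:ℝ) 1, IntervalIntegrable φ volume u v := by
      intro u hu v hv
      exact (hc.mono (uIcc_subset_Icc hu hv)).intervalIntegrable
    rw [Finset.sum_Ico_succ_top hab, mul_add,
      ← intervalIntegral.integral_add_adjacent_intervals (I _ ha0 _ hb0) (I _ hb0 _ hb1)]
    have h1 := ih hb0.2
    have h2 : ∫ x in ((b:ℝ)/m)..(((b+1:ℕ):ℝ)/m), φ ((b:ℝ)/m)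
        ≤ ∫ x in ((b:ℝ)/m)..(((b+1:ℕ):ℝ)/m), φ x := by
      refine intervalIntegral.integral_mono_on hlt (by simp) (I _ hb0 _ hb1) fun x hx => ?_
      exact hφ hb0 ⟨hb0.1.trans hx.1, hx.2.trans hb⟩ hx.1
    rw [intervalIntegral.integral_const, smul_eq_mul] at h2
    have h3 : ((b+1:ℕ):ℝ)/m - (b:ℝ)/m = 1 / m := by push_cast; ring
    rw [h3] at h2
    linarith

lemma trap_cell {Q : ℝ → ℝ}
    (hQ : ∀ s ∈ Icc (0:ℝ) 1, ∀ t ∈ Icc (0:ℝ) 1, Q s ≤ Q t + |s - t|) {a b : ℝ}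
    (ha : a ∈ Icc (0:ℝ) 1) (hb : b ∈ Icc (0:ℝ) 1) (hab : a ≤ b) :
    (b - a) * ((Q a + Q b) / 2) ≤ (∫ x in a..b, Q x) + (b - a)^2 / 4 := by
  have hc : (a+b)/2 ∈ Icc (0:ℝ) 1 := ⟨by linarith [ha.1, hb.1], by linarith [ha.2, hb.2]⟩
  rw [← intervalIntegral.integral_add_adjacent_intervals (lip_int hQ ha hc) (lip_int hQ hc hb)]
  have e1 : ∫ x in a..((a+b)/2), (Q a + a - x) ≤ ∫ x in a..((a+b)/2), Q x := by
    refine intervalIntegral.integral_mono_on (by linarith)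
      (Continuous.intervalIntegrable (by fun_prop) _ _) (lip_int hQ ha hc) fun x hx => ?_
    have := hQ a ha x ⟨ha.1.trans hx.1, hx.2.trans hc.2⟩
    rw [abs_of_nonpos (by linarith [hx.1])] at this
    linarith
  have e2 : ∫ x in ((a+b)/2)..b, (Q b - b + x) ≤ ∫ x in ((a+b)/2)..b, Q x := by
    refine intervalIntegral.integral_mono_on (by linarith)
      (Continuous.intervalIntegrable (by fun_prop) _ _) (lip_int hQ hc hb) fun x hx => ?_
    have := hQ b hb x ⟨hc.1.trans hx.1, hx.2.trans hb.2⟩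
    rw [abs_of_nonneg (by linarith [hx.2])] at this
    linarith
  rw [intervalIntegral.integral_sub (by simp) (by simp)] at e1
  rw [intervalIntegral.integral_add (by simp) (by simp)] at e2
  simp only [intervalIntegral.integral_const, smul_eq_mul, integral_id] at e1 e2
  nlinarith

lemma trap {Q : ℝ → ℝ}
    (hQ : ∀ s ∈ Icc (0:ℝ) 1, ∀ t ∈ Icc (0:ℝ) 1, Q s ≤ Q t + |s - t|)
    {m : ℕ} (hm : 0 < m) (j : ℕ) (hj : (j:ℝ) / m ≤ 1) :
    (1 / (m:ℝ)) * ∑ k ∈ Finset.range j, (Q ((k:ℝ)/m) + Q (((k:ℝ)+1)/m)) / 2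
      ≤ (∫ x in (0:ℝ)..((j:ℝ)/m), Q x) + (j:ℝ)/m * (1 / (4 * m)) := by
  have hm' : (0:ℝ) < m := by exact_mod_cast hm
  induction j with
  | zero => simp
  | succ b ih =>
    push_cast at hj ⊢
    have hlt : (b:ℝ) / m ≤ ((b:ℝ)+1) / m := by gcongr; norm_num
    have hb0 : (b:ℝ)/m ∈ Icc (0:ℝ) 1 := ⟨by positivity, hlt.trans hj⟩
    have hb1 : ((b:ℝ)+1)/m ∈ Icc (0:ℝ) 1 := ⟨by positivity, hj⟩
    have h0 : (0:ℝ) ∈ Icc (0:ℝ) 1 := by simp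
    rw [Finset.sum_range_succ, mul_add,
      ← intervalIntegral.integral_add_adjacent_intervals (lip_int hQ h0 hb0) (lip_int hQ hb0 hb1)]
    have h1 := ih hb0.2
    have h2 := trap_cell hQ hb0 hb1 hlt
    have h3 : ((b:ℝ)+1)/m - (b:ℝ)/m = 1 / m := by ring
    rw [h3] at h2
    have h4 : ((b:ℝ)+1)/m * (1 / (4 * m)) = (b:ℝ)/m * (1 / (4 * m)) + (1 / (m:ℝ))^2/4 := by
      field_simp
    linarith

lemma Good.qHat_le {g : ℝ → ℝ → ℝ} (G : Good g) {m : ℕ} (hm : 0 < m) {γ τ y : ℝ}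
    (hγ : 0 ≤ γ) (hγ1 : γ < 1) (hτ : 0 ≤ τ) (hτ1 : τ < 1) (hy : 0 ≤ y) (hyτ : y ≤ τ) :
    qHat g m γ τ y ≤ qFun g γ τ y + 1 / m := by
  have hm' : (0:ℝ) < m := by exact_mod_cast hm
  rw [← sub_le_iff_le_add]
  refine le_q hγ fun θ hθ => ?_
  rw [sub_le_iff_le_add]
  have hki : ⌊(m:ℝ) * θ⌋₊ ≤ ⌊(m:ℝ) * γ⌋₊ := by
    apply Nat.floor_le_floor; gcongr; exact hθ.2
  have hkθ : (⌊(m:ℝ) * θ⌋₊ : ℝ) ≤ m * θ := Nat.floor_le (mul_nonneg hm'.le hθ.1)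
  have hθk : m * θ < (⌊(m:ℝ) * θ⌋₊ : ℝ) + 1 := Nat.lt_floor_add_one _
  have hiγ : (⌊(m:ℝ) * γ⌋₊ : ℝ) ≤ m * γ := Nat.floor_le (by positivity)
  have hjτ : m * τ < (⌊(m:ℝ) * τ⌋₊ : ℝ) + 1 := Nat.lt_floor_add_one _
  have hjm : ⌊(m:ℝ) * τ⌋₊ + 1 ≤ m := by
    rw [Nat.succ_le_iff, Nat.floor_lt (by positivity)]
    nlinarith
  unfold qHat
  refine (Finset.inf'_le _ (b := ⌊(m:ℝ) * θ⌋₊) (by simp; omega)).trans ?_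
  generalize ⌊(m:ℝ) * θ⌋₊ = k at *
  generalize ⌊(m:ℝ) * γ⌋₊ = i at *
  generalize ⌊(m:ℝ) * τ⌋₊ = j at *
  have hjm' : (j:ℝ) + 1 ≤ m := by exact_mod_cast hjm
  have kθ : (k:ℝ)/m ≤ θ := by rw [div_le_iff₀ hm']; linarith
  have θk : θ ≤ (k:ℝ)/m + 1/m := by
    rw [← add_div, le_div_iff₀ hm']; linarith
  have iγ : (i:ℝ)/m ≤ γ := by rw [div_le_iff₀ hm']; linarith
  have τj : τ ≤ ((j:ℝ)+1)/m := by rw [le_div_iff₀ hm']; linarith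
  have jI : ((j:ℝ)+1)/m ∈ Icc (0:ℝ) 1 := ⟨by positivity, by rw [div_le_one hm']; exact hjm'⟩
  have θI : θ ∈ Icc (0:ℝ) 1 := ⟨hθ.1, by linarith [hθ.2]⟩
  have kI : (k:ℝ)/m ∈ Icc (0:ℝ) 1 := ⟨by positivity, by linarith [θI.2]⟩
  have iI : (i:ℝ)/m ∈ Icc (0:ℝ) 1 := ⟨by positivity, by linarith⟩
  have γI : γ ∈ Icc (0:ℝ) 1 := ⟨hγ, hγ1.le⟩
  have τI : τ ∈ Icc (0:ℝ) 1 := ⟨hτ, hτ1.le⟩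
  have yI : y ∈ Icc (0:ℝ) 1 := ⟨hy, by linarith⟩
  have zI : (0:ℝ) ∈ Icc (0:ℝ) 1 := by simp
  have s1 := riemann (G.mono y yI) (G.cont y yI) hm (Nat.zero_le k) kI.2
  rw [Nat.Ico_zero_eq_range] at s1
  simp only [Nat.cast_zero, zero_div] at s1
  have s2 := riemann (G.mono τ τI) (G.cont τ τI) hm hki iI.2
  have s3 : (1 / (m:ℝ)) * ∑ d ∈ Finset.Ico k i, g ((d:ℝ) / m) (((j:ℝ) + 1) / m)
      ≤ (1 / (m:ℝ)) * ∑ d ∈ Finset.Ico k i, g ((d:ℝ) / m) τ := by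
    gcongr with d hd
    have hd' : (d:ℝ) ≤ i := by exact_mod_cast (Finset.mem_Ico.1 hd).2.le
    refine G.anti _ ⟨by positivity, le_trans ?_ iI.2⟩ τI jI τj
    gcongr
  have s4 := intervalIntegral.integral_add_adjacent_intervals (G.int τI kI iI) (G.int τI iI γI)
  have s5 := intervalIntegral.integral_add_adjacent_intervals (G.int τI kI θI) (G.int τI θI γI)
  have s6 := intervalIntegral.integral_add_adjacent_intervals (G.int yI zI kI) (G.int yI kI θI)
  have s7 := G.int_nonneg τI iI.1 iγ hγ1.le
  have s8 : ∫ x in ((k:ℝ)/m)..θ, g x τ ≤ ∫ x in ((k:ℝ)/m)..θ, g x y := by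
    refine intervalIntegral.integral_mono_on kθ (G.int τI kI θI) (G.int yI kI θI) fun x hx => ?_
    exact G.anti x ⟨kI.1.trans hx.1, hx.2.trans θI.2⟩ yI τI hyτ
  have s9 := G.lipx _ kI _ θI _ yI kθ
  unfold hFun
  linarith

lemma Good.fHat_le {g : ℝ → ℝ → ℝ} (G : Good g) {m : ℕ} (hm : 0 < m) {γ τ : ℝ}
    (hγ : 0 ≤ γ) (hγ1 : γ < 1) (hτ : 0 ≤ τ) (hτ1 : τ < 1) :
    fHat g m γ τ ≤ fFun g γ τ + 5 / (4 * m) := by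
  have hm' : (0:ℝ) < m := by exact_mod_cast hm
  have γI : γ ∈ Icc (0:ℝ) 1 := ⟨hγ, hγ1.le⟩
  have τI : τ ∈ Icc (0:ℝ) 1 := ⟨hτ, hτ1.le⟩
  have zI : (0:ℝ) ∈ Icc (0:ℝ) 1 := by simp
  have hp : pHat g m γ τ ≤ pFun g γ τ := by
    unfold pHat pFun
    have hiγ : (⌊(m:ℝ) * γ⌋₊ : ℝ) ≤ m * γ := Nat.floor_le (by positivity)
    generalize ⌊(m:ℝ) * γ⌋₊ = i at *
    have iγ : (i:ℝ)/m ≤ γ := by rw [div_le_iff₀ hm']; linarith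
    have iI : (i:ℝ)/m ∈ Icc (0:ℝ) 1 := ⟨by positivity, by linarith⟩
    have s1 := riemann (G.mono τ τI) (G.cont τ τI) hm (Nat.zero_le i) iI.2
    rw [Nat.Ico_zero_eq_range] at s1
    simp only [Nat.cast_zero, zero_div] at s1
    have s4 := intervalIntegral.integral_add_adjacent_intervals (G.int τI zI iI) (G.int τI iI γI)
    have s7 := G.int_nonneg τI iI.1 iγ hγ1.le
    have : 0 ≤ 1 - τ := by linarith
    gcongr
    linarith
  have hjτ : (⌊(m:ℝ) * τ⌋₊ : ℝ) ≤ m * τ := Nat.floor_le (by positivity)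
  unfold fHat fFun
  generalize ⌊(m:ℝ) * τ⌋₊ = j at *
  have jτ : (j:ℝ)/m ≤ τ := by rw [div_le_iff₀ hm']; linarith
  have jI : (j:ℝ)/m ∈ Icc (0:ℝ) 1 := ⟨by positivity, by linarith⟩
  have t1 := trap (Q := fun y => qFun g γ τ y) (fun _ hs _ ht => G.q_lip γI τI hs ht) hm j jI.2
  have t2 : (1 / (m:ℝ)) * ∑ k ∈ Finset.range j,
      (qHat g m γ τ ((k:ℝ) / m) + qHat g m γ τ (((k:ℝ) + 1) / m)) / 2 ≤
      (1 / (m:ℝ)) * ∑ k ∈ Finset.range j,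
      ((qFun g γ τ ((k:ℝ) / m) + qFun g γ τ (((k:ℝ) + 1) / m)) / 2 + 1 / m) := by
    gcongr with k hk
    have hk' : (k:ℝ) + 1 ≤ j := by exact_mod_cast (Finset.mem_range.1 hk)
    have k1 : ((k:ℝ)+1)/m ≤ τ := le_trans (by gcongr) jτ
    have k0 : (k:ℝ)/m ≤ τ := le_trans (by gcongr; linarith) k1
    have a1 := G.qHat_le hm hγ hγ1 hτ hτ1 (y := (k:ℝ)/m) (by positivity) k0
    have a2 := G.qHat_le hm hγ hγ1 hτ hτ1 (y := ((k:ℝ)+1)/m) (by positivity) k1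
    linarith
  rw [Finset.sum_add_distrib, mul_add, Finset.sum_const, Finset.card_range, nsmul_eq_mul] at t2
  have s4 := intervalIntegral.integral_add_adjacent_intervals
    (G.q_int γI τI zI jI) (G.q_int γI τI jI τI)
  have s5 : 0 ≤ ∫ y in ((j:ℝ)/m)..τ, qFun g γ τ y :=
    intervalIntegral.integral_nonneg jτ
      fun y hy => G.q_nonneg γI τI ⟨jI.1.trans hy.1, hy.2.trans τI.2⟩
  have e1 : 1 / (m:ℝ) * (j * (1/m)) + (j:ℝ)/m * (1 / (4 * m)) = (j:ℝ)/m * (5 / (4 * m)) := by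
    field_simp; norm_num
  have e2 : (j:ℝ)/m * (5 / (4 * m)) ≤ 5 / (4 * m) :=
    mul_le_of_le_one_left (by positivity) jI.2
  linarith

lemma Good.f_gamma {g : ℝ → ℝ → ℝ} (G : Good g) {γ γ' τ : ℝ}
    (γI : γ ∈ Icc (0:ℝ) 1) (γI' : γ' ∈ Icc (0:ℝ) 1) (τI : τ ∈ Icc (0:ℝ) 1) (h : γ ≤ γ') :
    fFun g γ τ ≤ fFun g γ' τ + (γ' - γ) := by
  have zI : (0:ℝ) ∈ Icc (0:ℝ) 1 := by simp
  have hq : ∀ y ∈ Icc (0:ℝ) τ, qFun g γ τ y ≤ qFun g γ' τ y + (γ' - γ) := by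
    intro y hy
    have yI : y ∈ Icc (0:ℝ) 1 := ⟨hy.1, hy.2.trans τI.2⟩
    rw [← sub_le_iff_le_add]
    refine le_q γI'.1 fun θ hθ => ?_
    have θI : θ ∈ Icc (0:ℝ) 1 := ⟨hθ.1, hθ.2.trans γI'.2⟩
    rcases le_total θ γ with hθγ | hθγ
    · have a := G.q_le γI.2 τI yI ⟨hθ.1, hθγ⟩
      have b := intervalIntegral.integral_add_adjacent_intervals (G.int τI θI γI) (G.int τI γI γI')
      have c := G.int_nonneg τI γI.1 h γI'.2
      unfold hFun at *
      linarith
    · have a := G.q_le γI.2 τI yI ⟨γI.1, le_rfl⟩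
      have b := intervalIntegral.integral_add_adjacent_intervals (G.int yI zI γI) (G.int yI γI θI)
      have c := G.int_nonneg yI γI.1 hθγ θI.2
      have d := G.int_nonneg τI θI.1 hθ.2 γI'.2
      have e := G.lipx _ γI _ θI _ yI hθγ
      have e' := hθ.2
      unfold hFun at *
      rw [intervalIntegral.integral_same] at a
      linarith
  have hi : ∫ y in (0:ℝ)..τ, qFun g γ τ y ≤ ∫ y in (0:ℝ)..τ, (qFun g γ' τ y + (γ' - γ)) :=
    intervalIntegral.integral_mono_on τI.1 (G.q_int γI τI zI τI)
      ((G.q_int γI' τI zI τI).add (by simp)) hq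
  rw [intervalIntegral.integral_add (G.q_int γI' τI zI τI) (by simp)] at hi
  simp only [intervalIntegral.integral_const, smul_eq_mul] at hi
  have b := intervalIntegral.integral_add_adjacent_intervals (G.int τI zI γI) (G.int τI γI γI')
  have c := G.int_nonneg τI γI.1 h γI'.2
  have d := mul_nonneg (sub_nonneg.2 τI.2) c
  unfold fFun pFun
  rw [← b]
  nlinarith

lemma Good.f_tau {g : ℝ → ℝ → ℝ} (G : Good g) {γ τ τ' : ℝ}
    (γI : γ ∈ Icc (0:ℝ) 1) (τI : τ ∈ Icc (0:ℝ) 1) (τI' : τ' ∈ Icc (0:ℝ) 1) (h : τ ≤ τ') :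
    fFun g γ τ ≤ fFun g γ τ' + (τ' - τ) := by
  have zI : (0:ℝ) ∈ Icc (0:ℝ) 1 := by simp
  have hG : ∀ θ ∈ Icc (0:ℝ) γ, ∫ x in θ..γ, g x τ ≤
      (∫ x in θ..γ, g x τ') + (τ' - τ) * ((γ - θ) - ∫ x in θ..γ, g x τ') := by
    intro θ hθ
    have θI : θ ∈ Icc (0:ℝ) 1 := ⟨hθ.1, hθ.2.trans γI.2⟩
    have i1 := G.int τI θI γI
    have i2 := G.int τI' θI γI
    have i3 : IntervalIntegrable (fun x => (τ' - τ) * (1 - g x τ')) volume θ γ :=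
      (IntervalIntegrable.sub (by simp) i2).const_mul _
    have e : ∫ x in θ..γ, g x τ ≤ ∫ x in θ..γ, (g x τ' + (τ' - τ) * (1 - g x τ')) := by
      refine intervalIntegral.integral_mono_on hθ.2 i1 (i2.add i3) fun x hx => ?_
      have := G.lipy x ⟨hθ.1.trans hx.1, hx.2.trans γI.2⟩ τ τI τ' τI' h
      linarith
    rw [intervalIntegral.integral_add i2 i3, intervalIntegral.integral_const_mul,
      intervalIntegral.integral_sub (by simp) i2] at e
    simpa using e
  set A := ∫ x in (0:ℝ)..γ, g x τ' with hA
  have hq : ∀ y ∈ Icc (0:ℝ) τ,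
      qFun g γ τ y ≤ qFun g γ τ' y + (τ' - τ) * (γ - A) := by
    intro y hy
    have yI : y ∈ Icc (0:ℝ) 1 := ⟨hy.1, hy.2.trans τI.2⟩
    rw [← sub_le_iff_le_add]
    refine le_q γI.1 fun θ hθ => ?_
    have θI : θ ∈ Icc (0:ℝ) 1 := ⟨hθ.1, hθ.2.trans γI.2⟩
    have a := G.q_le γI.2 τI yI hθ
    have b := hG θ hθ
    have c := intervalIntegral.integral_add_adjacent_intervals (G.int τI' zI θI) (G.int τI' θI γI)
    have d : ∫ x in (0:ℝ)..θ, g x τ' ≤ ∫ x in (0:ℝ)..θ, (1:ℝ) :=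
      intervalIntegral.integral_mono_on hθ.1 (G.int τI' zI θI) (by simp)
        fun x hx => G.le_one x ⟨hx.1, hx.2.trans θI.2⟩ _ τI'
    simp only [intervalIntegral.integral_const, smul_eq_mul, sub_zero, mul_one] at d
    unfold hFun at *
    have e : (τ' - τ) * ((γ - θ) - ∫ x in θ..γ, g x τ') ≤ (τ' - τ) * (γ - A) := by
      apply mul_le_mul_of_nonneg_left _ (by linarith)
      linarith
    linarith
  have hi : ∫ y in (0:ℝ)..τ, qFun g γ τ y ≤
      ∫ y in (0:ℝ)..τ, (qFun g γ τ' y + (τ' - τ) * (γ - A)) :=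
    intervalIntegral.integral_mono_on τI.1 (G.q_int γI τI zI τI)
      ((G.q_int γI τI' zI τI).add (by simp)) hq
  rw [intervalIntegral.integral_add (G.q_int γI τI' zI τI) (by simp)] at hi
  simp only [intervalIntegral.integral_const, smul_eq_mul, sub_zero] at hi
  have s4 := intervalIntegral.integral_add_adjacent_intervals
    (G.q_int γI τI' zI τI) (G.q_int γI τI' τI τI')
  have s5 : 0 ≤ ∫ y in τ..τ', qFun g γ τ' y :=
    intervalIntegral.integral_nonneg h
      fun y hy => G.q_nonneg γI τI' ⟨τI.1.trans hy.1, hy.2.trans τI'.2⟩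
  have b := mul_le_mul_of_nonneg_left (hG 0 ⟨le_rfl, γI.1⟩) (sub_nonneg.2 τI.2)
  rw [← hA, sub_zero] at b
  unfold fFun pFun
  rw [← hA]
  nlinarith

lemma grid {n : ℕ} (hn : 0 < n) {x : ℝ} (hx : x ∈ Icc (0:ℝ) 1) :
    ∃ k < n, (k:ℝ)/n ≤ x ∧ x - (k:ℝ)/n ≤ 1 / n := by
  have hn' : (0:ℝ) < n := by exact_mod_cast hn
  rcases hx.2.lt_or_eq with h | h
  · refine ⟨⌊(n:ℝ) * x⌋₊, ?_, ?_, ?_⟩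
    · rw [Nat.floor_lt (mul_nonneg hn'.le hx.1)]; nlinarith
    · rw [div_le_iff₀ hn', mul_comm x]
      exact Nat.floor_le (mul_nonneg hn'.le hx.1)
    · rw [sub_le_iff_le_add, ← add_div, le_div_iff₀ hn']
      linarith [Nat.lt_floor_add_one ((n:ℝ) * x)]
  · refine ⟨n - 1, by omega, ?_, ?_⟩ <;> rw [Nat.cast_sub hn, h]
    · rw [div_le_one hn']; simp
    · rw [sub_div, div_self hn'.ne']; simp

theorem stmt10 (g gx gy : ℝ → ℝ → ℝ)
    (hcont : ContinuousOn (Function.uncurry g) (Set.Icc 0 1 ×ˢ Set.Icc 0 1))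
    (hrange : ∀ x ∈ Set.Icc (0:ℝ) 1, ∀ y ∈ Set.Icc (0:ℝ) 1, g x y ∈ Set.Icc (0:ℝ) 1)
    (hmono : ∀ y ∈ Set.Icc (0:ℝ) 1, MonotoneOn (fun x => g x y) (Set.Icc 0 1))
    (hanti : ∀ x ∈ Set.Icc (0:ℝ) 1, AntitoneOn (fun y => g x y) (Set.Icc 0 1))
    (hderx : ∀ x ∈ Set.Icc (0:ℝ) 1, ∀ y ∈ Set.Icc (0:ℝ) 1,
      HasDerivWithinAt (fun x' => g x' y) (gx x y) (Set.Icc 0 1) x)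
    (hC3 : ∀ x ∈ Set.Icc (0:ℝ) 1, ∀ y ∈ Set.Icc (0:ℝ) 1, gx x y ≤ g x y)
    (hdery : ∀ x ∈ Set.Icc (0:ℝ) 1, ∀ y ∈ Set.Icc (0:ℝ) 1,
      HasDerivWithinAt (fun y' => g x y') (gy x y) (Set.Icc 0 1) y)
    (hC4 : ∀ x ∈ Set.Icc (0:ℝ) 1, ∀ y ∈ Set.Icc (0:ℝ) 1, g x y - 1 ≤ gy x y)
    (n m : ℕ) (hn : 0 < n) (hm : 0 < m) :
    ((Finset.range n) ×ˢ (Finset.range n)).inf'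
        ((Finset.nonempty_range_iff.mpr hn.ne').product (Finset.nonempty_range_iff.mpr hn.ne'))
        (fun kl => fHat g m ((kl.1 : ℝ) / n) ((kl.2 : ℝ) / n)) ≤
      sInf ((fun pt : ℝ × ℝ => fFun g pt.1 pt.2) '' (Set.Icc 0 1 ×ˢ Set.Icc 0 1))
        + 2 / n + 5 / (4 * m) := by
  have G : Good g :=
    { nonneg := fun x hx y hy => (hrange x hx y hy).1
      le_one := fun x hx y hy => (hrange x hx y hy).2
      mono := hmono
      anti := hanti
      cont := fun y hy x hx => (hderx x hx y hy).continuousWithinAt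
      lipx := by
        intro x hx x' hx' y hy h
        have := mvt_le (fun x => g x y) (fun x => gx x y) 1 x x' hx.1 h hx'.2
          (fun t ht => hderx t ht y hy) (fun t ht => by
            have tI : t ∈ Set.Icc (0:ℝ) 1 := ⟨hx.1.trans ht.1, ht.2.trans hx'.2⟩
            exact (hC3 t tI y hy).trans (hrange t tI y hy).2)
        linarith
      lipy := by
        intro x hx y hy y' hy' h
        have := mvt_le (fun y => - g x y) (fun y => - gy x y) (1 - g x y') y y' hy.1 h hy'.2
          (fun t ht => (hdery x hx t ht).neg) (fun t ht => by
            have tI : t ∈ Set.Icc (0:ℝ) 1 := ⟨hy.1.trans ht.1, ht.2.trans hy'.2⟩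
            have h1 := hC4 x hx t tI
            have h2 : g x y' ≤ g x t := hanti x hx tI hy' ht.2
            linarith)
        linarith }
  have hn' : (0:ℝ) < n := by exact_mod_cast hn
  rw [add_assoc, ← sub_le_iff_le_add]
  refine le_csInf ⟨_, (0, 0), by simp, rfl⟩ ?_
  rintro _ ⟨⟨γ, τ⟩, ⟨hγ, hτ⟩, rfl⟩
  simp only at hγ hτ ⊢
  rw [sub_le_iff_le_add]
  obtain ⟨k, hk, hk1, hk2⟩ := grid hn hγ
  obtain ⟨l, hl, hl1, hl2⟩ := grid hn hτ
  refine (Finset.inf'_le _ (b := (k, l)) (by simp [hk, hl])).trans ?_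
  have kI : (k:ℝ)/n ∈ Set.Icc (0:ℝ) 1 := ⟨by positivity, hk1.trans hγ.2⟩
  have lI : (l:ℝ)/n ∈ Set.Icc (0:ℝ) 1 := ⟨by positivity, hl1.trans hτ.2⟩
  have a := G.fHat_le hm kI.1 (by rw [div_lt_one hn']; exact_mod_cast hk)
    lI.1 (by rw [div_lt_one hn']; exact_mod_cast hl)
  have b := G.f_gamma kI hγ lI hk1
  have c := G.f_tau hγ lI hτ hl1
  have d : (2:ℝ) / n = 1 / n + 1 / n := by ring
  simp only
  linarith
end

section
/- Let g satisfy conditions (C1), (C2), (C4). Fix x ∈ [0,1] and τ ∈ [0,1]. Then the function t ↦ g(x,t) + (t − τ)·(1 − g(x,t)) is nondecreasing on [τ, 1]; in particular, for every t ∈ [τ, 1], g(x,t) + (t − τ)·(1 − g(x,t)) ≥ g(x,τ). -/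
open Set MeasureTheory

theorem stmt17 (g gy : ℝ → ℝ → ℝ)
    (hcont : ContinuousOn (Function.uncurry g) (Set.Icc 0 1 ×ˢ Set.Icc 0 1))
    (hrange : ∀ x ∈ Set.Icc (0:ℝ) 1, ∀ y ∈ Set.Icc (0:ℝ) 1, g x y ∈ Set.Icc (0:ℝ) 1)
    (hmono : ∀ y ∈ Set.Icc (0:ℝ) 1, MonotoneOn (fun x => g x y) (Set.Icc 0 1))
    (hanti : ∀ x ∈ Set.Icc (0:ℝ) 1, AntitoneOn (fun y => g x y) (Set.Icc 0 1))
    (hdery : ∀ x ∈ Set.Icc (0:ℝ) 1, ∀ y ∈ Set.Icc (0:ℝ) 1,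
      HasDerivWithinAt (fun y' => g x y') (gy x y) (Set.Icc 0 1) y)
    (hC4 : ∀ x ∈ Set.Icc (0:ℝ) 1, ∀ y ∈ Set.Icc (0:ℝ) 1, g x y - 1 ≤ gy x y)
    (x τ : ℝ) (hx : x ∈ Set.Icc (0:ℝ) 1) (hτ : τ ∈ Set.Icc (0:ℝ) 1) :
    MonotoneOn (fun t => g x t + (t - τ) * (1 - g x t)) (Set.Icc τ 1) ∧
    ∀ t ∈ Set.Icc τ 1, g x τ ≤ g x t + (t - τ) * (1 - g x t) := by
  have hsub : Set.Icc τ 1 ⊆ Set.Icc (0:ℝ) 1 := Set.Icc_subset_Icc_left hτ.1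
  have hd : ∀ t ∈ Set.Icc τ 1, HasDerivWithinAt (fun t => g x t + (t - τ) * (1 - g x t))
      (gy x t + (1 * (1 - g x t) + (t - τ) * (- gy x t))) (Set.Icc τ 1) t := by
    intro t ht
    have h := (hdery x hx t (hsub ht)).mono hsub
    exact h.add (((hasDerivWithinAt_id t _).sub_const τ).mul (h.const_sub 1))
  have hm : MonotoneOn (fun t => g x t + (t - τ) * (1 - g x t)) (Set.Icc τ 1) := by
    refine monotoneOn_of_hasDerivWithinAt_nonneg (convex_Icc τ 1)
      (fun t ht => (hd t ht).continuousWithinAt)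
      (fun t ht => (hd t (interior_subset ht)).mono interior_subset) ?_
    intro t ht
    have ht := interior_subset ht
    have h1 := hC4 x hx t (hsub ht)
    have h2 := (hrange x hx t (hsub ht)).2
    have h3 : 0 ≤ 1 - (t - τ) := by linarith [ht.2, hτ.1]
    have h4 : 0 ≤ t - τ := by linarith [ht.1]
    nlinarith [mul_nonneg h3 (sub_nonneg.2 h1), mul_nonneg h4 (sub_nonneg.2 h2)]
  refine ⟨hm, fun t ht => ?_⟩
  have h := hm (Set.left_mem_Icc.2 hτ.2) ht ht.1
  simpa using h
end

section
/- Let g satisfy conditions (C1), (C2), (C3). Fix x ∈ [0,1] and γ ∈ [0,1]. Then the function θ ↦ (1 − g(θ,x)) + (θ − γ)·g(θ,x) is nondecreasing on [γ, 1]; in particular, for every θ ∈ [γ, 1], (1 − g(θ,x)) + (θ − γ)·g(θ,x) ≥ 1 − g(γ,x). -/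
open Set MeasureTheory

theorem stmt18 (g gx : ℝ → ℝ → ℝ)
    (hcont : ContinuousOn (Function.uncurry g) (Set.Icc 0 1 ×ˢ Set.Icc 0 1))
    (hrange : ∀ x ∈ Set.Icc (0:ℝ) 1, ∀ y ∈ Set.Icc (0:ℝ) 1, g x y ∈ Set.Icc (0:ℝ) 1)
    (hmono : ∀ y ∈ Set.Icc (0:ℝ) 1, MonotoneOn (fun x => g x y) (Set.Icc 0 1))
    (hanti : ∀ x ∈ Set.Icc (0:ℝ) 1, AntitoneOn (fun y => g x y) (Set.Icc 0 1))
    (hderx : ∀ x ∈ Set.Icc (0:ℝ) 1, ∀ y ∈ Set.Icc (0:ℝ) 1,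
      HasDerivWithinAt (fun x' => g x' y) (gx x y) (Set.Icc 0 1) x)
    (hC3 : ∀ x ∈ Set.Icc (0:ℝ) 1, ∀ y ∈ Set.Icc (0:ℝ) 1, gx x y ≤ g x y)
    (x γ : ℝ) (hx : x ∈ Set.Icc (0:ℝ) 1) (hγ : γ ∈ Set.Icc (0:ℝ) 1) :
    MonotoneOn (fun θ => (1 - g θ x) + (θ - γ) * g θ x) (Set.Icc γ 1) ∧
    ∀ θ ∈ Set.Icc γ 1, 1 - g γ x ≤ (1 - g θ x) + (θ - γ) * g θ x := by
  have hsub : Set.Icc γ 1 ⊆ Set.Icc (0:ℝ) 1 := Set.Icc_subset_Icc_left hγ.1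
  have hder : ∀ θ ∈ Set.Icc γ 1, HasDerivWithinAt (fun θ => (1 - g θ x) + (θ - γ) * g θ x)
      (-gx θ x + (1 * g θ x + (θ - γ) * gx θ x)) (Set.Icc γ 1) θ := by
    intro θ hθ
    have h := (hderx θ (hsub hθ) x hx).mono hsub
    exact (h.const_sub 1).add (((hasDerivWithinAt_id θ _).sub_const γ).mul h)
  have hm : MonotoneOn (fun θ => (1 - g θ x) + (θ - γ) * g θ x) (Set.Icc γ 1) := by
    refine monotoneOn_of_hasDerivWithinAt_nonneg (convex_Icc γ 1)
      (fun θ hθ => (hder θ hθ).continuousWithinAt)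
      (fun θ hθ => (hder θ (interior_subset hθ)).mono interior_subset) ?_
    intro θ hθ
    have hθ' := interior_subset hθ
    have h1 := hC3 θ (hsub hθ') x hx
    have h2 := (hrange θ (hsub hθ') x hx).1
    have h3 : 0 ≤ θ - γ := sub_nonneg.2 hθ'.1
    have h4 : 0 ≤ 1 - (θ - γ) := by linarith [hθ'.2, hγ.1]
    nlinarith [mul_nonneg h4 (sub_nonneg.2 h1), mul_nonneg h3 h2]
  refine ⟨hm, fun θ hθ => ?_⟩
  have h := hm (Set.left_mem_Icc.2 hγ.2) hθ hθ.1
  simpa using h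
end

section
/- (Theorem 7.1.) For every function g satisfying conditions (C1)–(C5), the value of the competitive-ratio bound, namely min over (γ,τ) ∈ [0,1]² of f(γ,τ), is at most 0.6688. -/
open Set MeasureTheory

lemma logAux1 : (0.6095 : ℝ) ≤ Real.log 1.84 := by
  rw [Real.le_log_iff_exp_le (by norm_num)]
  have h := Real.exp_bound' (x := 0.6095) (by norm_num) (by norm_num) (n := 7) (by norm_num)
  refine h.trans ?_
  norm_num [Finset.sum_range_succ, Nat.factorial]

lemma logAux2 : Real.log 1.84 ≤ 0.61 := by
  rw [Real.log_le_iff_le_exp (by norm_num)]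
  have h := Real.sum_le_exp_of_nonneg (x := 0.61) (by norm_num) 7
  refine le_trans ?_ h
  norm_num [Finset.sum_range_succ, Nat.factorial]

lemma polyAux (y : ℝ) (h0 : 0 ≤ y) (h1 : y ≤ 1) :
    (Real.exp y - 1) * (0.84 / (1 + 0.84 * y)) ≤ 0.84 * y - 0.23 * y ^ 2 + 0.18 * y ^ 3 := by
  have h := Real.exp_bound' (x := y) h0 h1 (n := 5) (by norm_num)
  norm_num [Finset.sum_range_succ, Nat.factorial] at h
  have hp : 0 < 1 + 0.84 * y := by positivity
  rw [← mul_div_assoc, div_le_iff₀ hp]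
  have h2 : y ^ 2 * (0.0556 - 0.1532 * y + 0.1078 * y ^ 2) ≥ 0 := by
    apply mul_nonneg (sq_nonneg y)
    nlinarith [sq_nonneg (y - 0.7106)]
  nlinarith [mul_nonneg (pow_nonneg h0 4) (sub_nonneg.2 h1)]

/-- A function whose derivative is at most itself grows at most exponentially. -/
lemma growthAux (f f' : ℝ → ℝ)
    (hd : ∀ x ∈ Set.Icc (0:ℝ) 1, HasDerivWithinAt f (f' x) (Set.Icc 0 1) x)
    (hle : ∀ x ∈ Set.Icc (0:ℝ) 1, f' x ≤ f x) (x : ℝ) (hx : x ∈ Set.Icc (0:ℝ) 1) :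
    f x ≤ Real.exp x * f 0 := by
  have hA : AntitoneOn (fun x => f x * Real.exp (-x)) (Set.Icc 0 1) := by
    apply antitoneOn_of_hasDerivWithinAt_nonpos (convex_Icc 0 1)
      (f' := fun x => f' x * Real.exp (-x) + f x * (Real.exp (-x) * (-1)))
    · have h1 : ContinuousOn f (Set.Icc 0 1) := fun x hx => (hd x hx).continuousWithinAt
      fun_prop
    · intro x hx
      have hx' := interior_subset hx
      exact ((hd x hx').mono interior_subset).mul
        ((((hasDerivAt_id x).neg).exp).hasDerivWithinAt)
    · intro x hx
      have hx' := interior_subset hx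
      have := hle x hx'
      have := Real.exp_pos (-x)
      nlinarith
  have h := hA (by simp : (0:ℝ) ∈ Set.Icc (0:ℝ) 1) hx hx.1
  simp only [neg_zero, Real.exp_zero, mul_one] at h
  have e : Real.exp x * Real.exp (-x) = 1 := by rw [← Real.exp_add]; simp
  calc f x = Real.exp x * (f x * Real.exp (-x)) := by linear_combination (-f x) * e
    _ ≤ _ := by gcongr

theorem stmt19 (g gx gy : ℝ → ℝ → ℝ)
    (hcont : ContinuousOn (Function.uncurry g) (Set.Icc 0 1 ×ˢ Set.Icc 0 1))
    (hrange : ∀ x ∈ Set.Icc (0:ℝ) 1, ∀ y ∈ Set.Icc (0:ℝ) 1, g x y ∈ Set.Icc (0:ℝ) 1)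
    (hmono : ∀ y ∈ Set.Icc (0:ℝ) 1, MonotoneOn (fun x => g x y) (Set.Icc 0 1))
    (hanti : ∀ x ∈ Set.Icc (0:ℝ) 1, AntitoneOn (fun y => g x y) (Set.Icc 0 1))
    (hderx : ∀ x ∈ Set.Icc (0:ℝ) 1, ∀ y ∈ Set.Icc (0:ℝ) 1,
      HasDerivWithinAt (fun x' => g x' y) (gx x y) (Set.Icc 0 1) x)
    (hC3 : ∀ x ∈ Set.Icc (0:ℝ) 1, ∀ y ∈ Set.Icc (0:ℝ) 1, gx x y ≤ g x y)
    (hdery : ∀ x ∈ Set.Icc (0:ℝ) 1, ∀ y ∈ Set.Icc (0:ℝ) 1,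
      HasDerivWithinAt (fun y' => g x y') (gy x y) (Set.Icc 0 1) y)
    (hC4 : ∀ x ∈ Set.Icc (0:ℝ) 1, ∀ y ∈ Set.Icc (0:ℝ) 1, g x y - 1 ≤ gy x y)
    (hC5 : ∀ x ∈ Set.Icc (0:ℝ) 1, ∀ y ∈ Set.Icc (0:ℝ) 1, ∀ y' ∈ Set.Icc (0:ℝ) 1,
      y < y' → g 1 y' - g x y' ≤ g 1 y - g x y)
    :
    sInf ((fun pt : ℝ × ℝ => fFun g pt.1 pt.2) '' (Set.Icc 0 1 ×ˢ Set.Icc 0 1)) ≤ 0.6688 := by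
  have m0 : (0:ℝ) ∈ Set.Icc (0:ℝ) 1 := by simp
  have m1 : (1:ℝ) ∈ Set.Icc (0:ℝ) 1 := by simp
  by_cases hb : BddBelow ((fun pt : ℝ × ℝ => fFun g pt.1 pt.2) '' (Set.Icc 0 1 ×ˢ Set.Icc 0 1))
  swap
  · rw [Real.sInf_of_not_bddBelow hb]; norm_num
  have hf1 := csInf_le hb (Set.mem_image_of_mem _ (Set.mk_mem_prod m0 m1))
  have hf2 := csInf_le hb (Set.mem_image_of_mem _ (Set.mk_mem_prod m1 m0))
  have cu : ContinuousOn (fun y => g 0 y) (Set.Icc 0 1) := fun y hy =>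
    (hdery 0 m0 y hy).continuousWithinAt
  have cphi : ContinuousOn (fun x => g x 0) (Set.Icc 0 1) := fun x hx =>
    (hderx x hx 0 m0).continuousWithinAt
  have iu : IntervalIntegrable (fun y => g 0 y) volume 0 1 :=
    ContinuousOn.intervalIntegrable (by rwa [Set.uIcc_of_le zero_le_one])
  have e1 : fFun g 0 1 = 1 - ∫ y in (0:ℝ)..1, g 0 y := by
    simp only [fFun, pFun, qFun, hFun, Set.Icc_self, Set.image_singleton, csInf_singleton,
      intervalIntegral.integral_same]
    simp [intervalIntegral.integral_sub, iu]
  have e2 : fFun g 1 0 = ∫ x in (0:ℝ)..1, g x 0 := by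
    simp [fFun, pFun]
  set s := g 1 0 with hs
  have hs1 : s ≤ 1 := (hrange 1 m1 0 m0).2
  -- pointwise bounds
  have key : ∀ x ∈ Set.Icc (0:ℝ) 1, ∀ y ∈ Set.Icc (0:ℝ) 1,
      g x 0 ≤ Real.exp x * g 0 y + (Real.exp y - 1) * (1 - s) := by
    intro x hx y hy
    have a1 := growthAux (fun x => g x y) (fun x => gx x y) (fun x hx => hderx x hx y hy)
      (fun x hx => hC3 x hx y hy) x hx
    have a2 := growthAux (fun y => 1 - g 1 y) (fun y => - gy 1 y)
      (fun y hy => (hdery 1 m1 y hy).const_sub 1)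
      (fun y hy => by have := hC4 1 m1 y hy; linarith) y hy
    have a3 : g 1 y - g x y ≤ g 1 0 - g x 0 := by
      rcases hy.1.eq_or_lt with h | h
      · rw [← h]
      · exact hC5 x hx 0 m0 y hy h
    linarith
  set x0 := Real.log 1.84 with hx0
  have l1 := logAux1
  have l2 := logAux2
  rw [← hx0] at l1 l2
  have hsub : ∀ y ∈ Set.Icc (0:ℝ) 1, Real.log (1 + 0.84 * y) ∈ Set.Icc (0:ℝ) 1 := by
    intro y hy
    refine ⟨Real.log_nonneg (by linarith [hy.1]), ?_⟩
    have : Real.log (1 + 0.84 * y) ≤ Real.log 1.84 :=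
      Real.log_le_log (by linarith [hy.1]) (by linarith [hy.2])
    linarith
  have hU : Set.uIcc (0:ℝ) 1 = Set.Icc 0 1 := Set.uIcc_of_le zero_le_one
  have cw : ContinuousOn (fun y : ℝ => 0.84 / (1 + 0.84 * y)) (Set.Icc 0 1) := by
    apply ContinuousOn.div (by fun_prop) (by fun_prop)
    intro y hy
    have := hy.1
    positivity
  have clog : ContinuousOn (fun y : ℝ => Real.log (1 + 0.84 * y)) (Set.Icc 0 1) := by
    apply ContinuousOn.log (by fun_prop)
    intro y hy
    have := hy.1
    positivity
  have cov : ∫ y in (0:ℝ)..1, g (Real.log (1 + 0.84 * y)) 0 * (0.84 / (1 + 0.84 * y))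
      = ∫ x in (0:ℝ)..x0, g x 0 := by
    have h := intervalIntegral.integral_comp_mul_deriv'' (a := 0) (b := 1)
      (f := fun y : ℝ => Real.log (1 + 0.84 * y)) (f' := fun y : ℝ => 0.84 / (1 + 0.84 * y))
      (g := fun x => g x 0) (by rwa [hU])
      (by
        intro y hy
        simp only [min_eq_left zero_le_one, max_eq_right zero_le_one] at hy
        have hy0 := hy.1
        have hd : HasDerivAt (fun y : ℝ => 1 + 0.84 * y) 0.84 y := by
          simpa using ((hasDerivAt_id y).const_mul (0.84:ℝ)).const_add 1
        exact (hd.log (by positivity)).hasDerivWithinAt)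
      (by rwa [hU])
      (by
        apply cphi.mono
        rintro _ ⟨y, hy, rfl⟩
        rw [hU] at hy
        exact hsub y hy)
    simp only [Function.comp_def] at h
    rw [h, hx0]
    norm_num
  have hA : ∫ x in (0:ℝ)..x0, g x 0 ≤ 0.84 * (∫ y in (0:ℝ)..1, g 0 y) + 0.38834 * (1 - s) := by
    rw [← cov]
    have hmon : ∫ y in (0:ℝ)..1, g (Real.log (1 + 0.84 * y)) 0 * (0.84 / (1 + 0.84 * y)) ≤
        ∫ y in (0:ℝ)..1, (0.84 * g 0 y + (0.84 * y - 0.23 * y ^ 2 + 0.18 * y ^ 3) * (1 - s)) := by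
      apply intervalIntegral.integral_mono_on zero_le_one
      · apply ContinuousOn.intervalIntegrable
        rw [hU]
        exact (cphi.comp clog hsub).mul cw
      · apply ContinuousOn.intervalIntegrable
        rw [hU]
        fun_prop
      · intro y hy
        have k := key _ (hsub y hy) y hy
        have hp : 0 < 1 + 0.84 * y := by have := hy.1; positivity
        rw [Real.exp_log hp] at k
        have hw : 0 < 0.84 / (1 + 0.84 * y) := by positivity
        have pa := mul_le_mul_of_nonneg_right (polyAux y hy.1 hy.2) (sub_nonneg.2 hs1)
        have k2 := mul_le_mul_of_nonneg_right k hw.le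
        have e : (1 + 0.84 * y) * (0.84 / (1 + 0.84 * y)) = 0.84 := by field_simp
        have e3 : ((1 + 0.84 * y) * g 0 y + (Real.exp y - 1) * (1 - s)) * (0.84 / (1 + 0.84 * y))
          = 0.84 * g 0 y + (Real.exp y - 1) * (0.84 / (1 + 0.84 * y)) * (1 - s) := by
          linear_combination (g 0 y) * e
        linarith
    refine hmon.trans ?_
    rw [intervalIntegral.integral_add (iu.const_mul _)
      (Continuous.intervalIntegrable (by fun_prop) _ _),
      intervalIntegral.integral_const_mul, intervalIntegral.integral_mul_const]
    have hpoly : ∫ y in (0:ℝ)..1, ((0.84:ℝ) * y - 0.23 * y ^ 2 + 0.18 * y ^ 3) ≤ 0.38834 := by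
      rw [intervalIntegral.integral_add (Continuous.intervalIntegrable (by fun_prop) _ _)
        (Continuous.intervalIntegrable (by fun_prop) _ _),
        intervalIntegral.integral_sub (Continuous.intervalIntegrable (by fun_prop) _ _)
        (Continuous.intervalIntegrable (by fun_prop) _ _)]
      have hlin : ∫ y in (0:ℝ)..1, (0.84:ℝ) * y = 0.42 := by
        rw [intervalIntegral.integral_const_mul, integral_id]
        norm_num
      rw [hlin]
      simp only [intervalIntegral.integral_const_mul, integral_pow]
      norm_num
    have := mul_le_mul_of_nonneg_right hpoly (sub_nonneg.2 hs1)
    linarith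
  have iphi : ∀ a ∈ Set.Icc (0:ℝ) 1, ∀ b ∈ Set.Icc (0:ℝ) 1,
      IntervalIntegrable (fun x => g x 0) volume a b := by
    intro a ha b hb
    exact (cphi.mono (Set.uIcc_subset_Icc ha hb)).intervalIntegrable
  have mx0 : x0 ∈ Set.Icc (0:ℝ) 1 := ⟨by linarith, by linarith⟩
  have hB : ∫ x in x0..1, g x 0 ≤ (1 - x0) * s := by
    have h := intervalIntegral.integral_mono_on (a := x0) (b := 1) (f := fun x => g x 0)
      (g := fun _ => s) mx0.2 (iphi _ mx0 _ m1) (by simp)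
      (fun x hx => hmono 0 m0 ⟨mx0.1.trans hx.1, hx.2⟩ m1 hx.2)
    simpa using h
  have hC := intervalIntegral.integral_add_adjacent_intervals (iphi _ m0 _ mx0) (iphi _ mx0 _ m1)
  simp only at hf1 hf2
  rw [e1] at hf1
  rw [e2] at hf2
  have hfin : ∫ x in (0:ℝ)..1, g x 0 ≤ 0.84 * (∫ y in (0:ℝ)..1, g 0 y) + (1 - x0) := by
    nlinarith
  linarith
end
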